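/- Let ω be a radial weight in the class D̂ and let 1<p,q<∞. Then the Bergman projection P_ω is bounded on L^{p,q}_ω: there exists a constant C>0 (depending only on p,q,ω) such that for every f∈L^{p,q}_ω, the integral defining P_ω f(z) converges absolutely for every z∈D, P_ω f is analytic on D, and ‖P_ω f‖_{L^{p,q}_ω} ≤ C‖f‖_{L^{p,q}_ω}. -/

import Mathlib

open MeasureTheory Filter Set
open scoped ENNReal

noncomputable section

/-- `ω̂(r) = ∫_r^1 ω(s) ds`. -/
def omegaHat (ω : ℝ → ℝ) (r : ℝ) : ℝ := ∫ s in r..1, ω s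

/-- A radial weight: nonnegative and Lebesgue integrable on `[0,1)`. -/
def IsRadialWeight (ω : ℝ → ℝ) : Prop :=
  (∀ r ∈ Set.Ico (0:ℝ) 1, 0 ≤ ω r) ∧ MeasureTheory.IntegrableOn ω (Set.Ico 0 1)

/-- The class `D̂` of upper doubling radial weights. -/
def InDhat (ω : ℝ → ℝ) : Prop :=
  ∃ C > (0:ℝ), ∀ r ∈ Set.Ico (0:ℝ) 1, omegaHat ω r ≤ C * omegaHat ω ((1 + r) / 2)

/-- The class `Ď`. -/
def InDcheck (ω : ℝ → ℝ) : Prop :=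
  ∃ K > (1:ℝ), ∃ C > (1:ℝ), ∀ r ∈ Set.Ico (0:ℝ) 1,
    C * omegaHat ω (1 - (1 - r) / K) ≤ omegaHat ω r

/-- Moments `μ_x = ∫_0^1 r^x μ(r) dr`. -/
def momentW (μ : ℝ → ℝ) (x : ℝ) : ℝ := ∫ r in (0:ℝ)..1, r ^ x * μ r

/-- The coefficients `μ_{2k+1}` of the `A²_μ` pairing. -/
def momentCoeff (μ : ℝ → ℝ) : ℕ → ℝ := fun k => momentW μ (2 * (k:ℝ) + 1)

/-- The point `r e^{iθ}` of the circle of radius `r`. -/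
def circlePt (r θ : ℝ) : ℂ := (r:ℂ) * Complex.exp ((θ:ℂ) * Complex.I)

/-- Integral means `M_p(r,f)` (with values in `[0,∞]`). -/
def MpE (p r : ℝ) (f : ℂ → ℂ) : ℝ≥0∞ :=
  (ENNReal.ofReal (1 / (2 * Real.pi)) *
    ∫⁻ θ in Set.Ioo (0:ℝ) (2 * Real.pi), ENNReal.ofReal (‖f (circlePt r θ)‖ ^ p)) ^ (1 / p)

/-- Integral means of a `[0,∞]`-valued function. -/
def MpEE (p r : ℝ) (F : ℂ → ℝ≥0∞) : ℝ≥0∞ :=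
  (ENNReal.ofReal (1 / (2 * Real.pi)) *
    ∫⁻ θ in Set.Ioo (0:ℝ) (2 * Real.pi), (F (circlePt r θ)) ^ p) ^ (1 / p)

/-- The norm of the mixed norm space `L^{p,q}_ω`. -/
def LpqNormE (ω : ℝ → ℝ) (p q : ℝ) (f : ℂ → ℂ) : ℝ≥0∞ :=
  (∫⁻ r in Set.Ioo (0:ℝ) 1, (MpE p r f) ^ q * ENNReal.ofReal (r * ω r)) ^ (1 / q)

/-- The `L^{p,q}_ω` norm of a `[0,∞]`-valued function. -/
def LpqNormEE (ω : ℝ → ℝ) (p q : ℝ) (F : ℂ → ℝ≥0∞) : ℝ≥0∞ :=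
  (∫⁻ r in Set.Ioo (0:ℝ) 1, (MpEE p r F) ^ q * ENNReal.ofReal (r * ω r)) ^ (1 / q)

/-- The norm of `A^{p,∞}_ω` : `sup_{0 ≤ r < 1} M_p(r,f) ω̂(r)`. -/
def ApInfNormE (ω : ℝ → ℝ) (p : ℝ) (f : ℂ → ℂ) : ℝ≥0∞ :=
  ⨆ r ∈ Set.Ico (0:ℝ) 1, MpE p r f * ENNReal.ofReal (omegaHat ω r)

/-- Membership in the mixed norm space `A^{p,q}_ω`. -/
def InApq (ω : ℝ → ℝ) (p q : ℝ) (f : ℂ → ℂ) : Prop :=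
  DifferentiableOn ℂ f (Metric.ball 0 1) ∧ LpqNormE ω p q f < ⊤

/-- Membership in `A^{p,∞}_ω`. -/
def InApInf (ω : ℝ → ℝ) (p : ℝ) (f : ℂ → ℂ) : Prop :=
  DifferentiableOn ℂ f (Metric.ball 0 1) ∧ ApInfNormE ω p f < ⊤

/-- Taylor coefficient of `f` at `0`. -/
def taylorCoeff (f : ℂ → ℂ) (n : ℕ) : ℂ := iteratedDeriv n f 0 / (n.factorial : ℂ)

/-- The pairing `⟨f,g⟩ = lim_{r→1⁻} ∑_k f̂(k) conj(ĝ(k)) c(k) r^k` exists and equals `l`. -/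
def HasPairingC (c : ℕ → ℝ) (f g : ℂ → ℂ) (l : ℂ) : Prop :=
  (∀ r ∈ Set.Ico (0:ℝ) 1, Summable (fun k : ℕ =>
    taylorCoeff f k * (starRingEnd ℂ) (taylorCoeff g k) * ((c k : ℝ) : ℂ) * ((r:ℂ)) ^ k)) ∧
  Filter.Tendsto (fun r : ℝ => ∑' k : ℕ,
    taylorCoeff f k * (starRingEnd ℂ) (taylorCoeff g k) * ((c k : ℝ) : ℂ) * ((r:ℂ)) ^ k)
    (nhdsWithin 1 (Set.Iio 1)) (nhds l)

/-- `L` is linear on the functions satisfying `P`. -/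
def IsLinearOn (P : (ℂ → ℂ) → Prop) (L : (ℂ → ℂ) → ℂ) : Prop :=
  (∀ f g : ℂ → ℂ, P f → P g → L (f + g) = L f + L g) ∧
  (∀ (c : ℂ) (f : ℂ → ℂ), P f → L (c • f) = c * L f)

/-- Dilation `f_r(z) = f(rz)`. -/
def dilateF (f : ℂ → ℂ) (r : ℝ) : ℂ → ℂ := fun z => f ((r:ℂ) * z)

/-- The BMOA norm `|f(0)| + sup_{a∈D} sup_{0<r<1} M₂(r, f∘φ_a - f(a))`. -/
def BMOANormE (f : ℂ → ℂ) : ℝ≥0∞ :=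
  ENNReal.ofReal ‖f 0‖ +
    ⨆ a ∈ Metric.ball (0:ℂ) 1, ⨆ r ∈ Set.Ioo (0:ℝ) 1,
      MpE 2 r (fun z => f ((a - z) / (1 - (starRingEnd ℂ) a * z)) - f a)

/-- The Bloch norm `|f(0)| + sup_{z∈D} (1-|z|²)|f'(z)|`. -/
def BlochNormE (f : ℂ → ℂ) : ℝ≥0∞ :=
  ENNReal.ofReal ‖f 0‖ +
    ⨆ z ∈ Metric.ball (0:ℂ) 1, ENNReal.ofReal ((1 - ‖z‖ ^ 2) * ‖deriv f z‖)

/-- The norm of `X(q,ω)`: `(∫_0^1 ‖f_r‖_X^q ω(r) dr)^{1/q}`. -/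
def XqNormE (Xnorm : (ℂ → ℂ) → ℝ≥0∞) (ω : ℝ → ℝ) (q : ℝ) (f : ℂ → ℂ) : ℝ≥0∞ :=
  (∫⁻ r in Set.Ioo (0:ℝ) 1, (Xnorm (dilateF f r)) ^ q * ENNReal.ofReal (ω r)) ^ (1 / q)

/-- The norm of `X(∞,ω)`: `sup_{0<r<1} ‖f_r‖_X ω̂(r)`. -/
def XInfNormE (Xnorm : (ℂ → ℂ) → ℝ≥0∞) (ω : ℝ → ℝ) (f : ℂ → ℂ) : ℝ≥0∞ :=
  ⨆ r ∈ Set.Ioo (0:ℝ) 1, Xnorm (dilateF f r) * ENNReal.ofReal (omegaHat ω r)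

/-- The standard radial weight `ν_β(r) = (β+1)(1-r²)^β`. -/
def nuWeight (β : ℝ) : ℝ → ℝ := fun r => (β + 1) * (1 - r ^ 2) ^ β

/-- The Bergman reproducing kernel `B^ω_a(z) = ∑ (z conj a)^n / (2 ω_{2n+1})`. -/
def bergmanKernel (ω : ℝ → ℝ) (a z : ℂ) : ℂ :=
  ∑' n : ℕ, (z * (starRingEnd ℂ) a) ^ n / (2 * ((momentW ω (2 * (n:ℝ) + 1) : ℝ) : ℂ))

/-- The Bergman projection (`dA` is normalized area measure). -/
def PomegaProj (ω : ℝ → ℝ) (f : ℂ → ℂ) (z : ℂ) : ℂ :=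
  (Real.pi)⁻¹ • ∫ ζ in Metric.ball (0:ℂ) 1,
    f ζ * (starRingEnd ℂ) (bergmanKernel ω z ζ) * ((ω ‖ζ‖ : ℝ) : ℂ)

/-- The maximal Bergman projection applied to `|f|`, with values in `[0,∞]`. -/
def PomegaPlusL (ω : ℝ → ℝ) (f : ℂ → ℂ) (z : ℂ) : ℝ≥0∞ :=
  ∫⁻ ζ in Metric.ball (0:ℂ) 1,
    ENNReal.ofReal (‖f ζ‖ * ‖bergmanKernel ω z ζ‖ * ω ‖ζ‖ / Real.pi)

/-- The Hardy `H¹` norm. -/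
def H1NormE (f : ℂ → ℂ) : ℝ≥0∞ := ⨆ r ∈ Set.Ioo (0:ℝ) 1, MpE 1 r f

/-- `r_n = inf{ r ∈ [0,1) : ω̂(r) = ω̂(0) K^{-n} }`. -/
def rSeq (ω : ℝ → ℝ) (K : ℝ) (n : ℕ) : ℝ :=
  sInf {r | r ∈ Set.Ico (0:ℝ) 1 ∧ omegaHat ω r = omegaHat ω 0 * K ^ (-(n:ℝ))}

/-- `M_n = ⌊1/(1-r_n)⌋`. -/
def MSeq (ω : ℝ → ℝ) (K : ℝ) (n : ℕ) : ℕ := ⌊1 / (1 - rSeq ω K n)⌋₊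

/-- Weighted Hadamard product of a polynomial with an analytic function:
`z ↦ ∑_j c(j) P̂(j) ĝ(j) z^j`. -/
def hadamardPolyC (c : ℕ → ℂ) (P : Polynomial ℂ) (g : ℂ → ℂ) : ℂ → ℂ :=
  fun z => ∑ j ∈ Finset.range (P.natDegree + 1), c j * P.coeff j * taylorCoeff g j * z ^ j

/-- An admissible Banach space of analytic functions on the unit disc, given by a
carrier set and a norm function. -/
structure AdmissibleSpace where
  carrier : Set (ℂ → ℂ)
  nrm : (ℂ → ℂ) → ℝ
  mem_analytic : ∀ f ∈ carrier, DifferentiableOn ℂ f (Metric.ball 0 1)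
  zero_mem : (0 : ℂ → ℂ) ∈ carrier
  add_mem : ∀ f g : ℂ → ℂ, f ∈ carrier → g ∈ carrier → f + g ∈ carrier
  smul_mem : ∀ (c : ℂ) (f : ℂ → ℂ), f ∈ carrier → c • f ∈ carrier
  nrm_nonneg : ∀ f ∈ carrier, 0 ≤ nrm f
  nrm_eq_zero : ∀ f ∈ carrier, nrm f = 0 → ∀ z ∈ Metric.ball (0:ℂ) 1, f z = 0
  nrm_add : ∀ f g : ℂ → ℂ, f ∈ carrier → g ∈ carrier → nrm (f + g) ≤ nrm f + nrm g
  nrm_smul : ∀ (c : ℂ) (f : ℂ → ℂ), f ∈ carrier → nrm (c • f) = ‖c‖ * nrm f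
  complete : ∀ u : ℕ → (ℂ → ℂ), (∀ n, u n ∈ carrier) →
    (∀ ε : ℝ, 0 < ε → ∃ N : ℕ, ∀ m ≥ N, ∀ n ≥ N, nrm (u m - u n) < ε) →
    ∃ f ∈ carrier, Filter.Tendsto (fun n => nrm (u n - f)) Filter.atTop (nhds 0)
  norm_conv_implies_ucc : ∀ (u : ℕ → (ℂ → ℂ)) (f : ℂ → ℂ),
    (∀ n, u n ∈ carrier) → f ∈ carrier →
    Filter.Tendsto (fun n => nrm (u n - f)) Filter.atTop (nhds 0) →
    ∀ Kc : Set ℂ, Kc ⊆ Metric.ball 0 1 → IsCompact Kc →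
      TendstoUniformlyOn (fun n => u n) f Filter.atTop Kc
  ucc_implies_norm_conv : ∀ R : ℝ, 1 < R → ∀ (u : ℕ → (ℂ → ℂ)) (f : ℂ → ℂ),
    (∀ n, u n ∈ carrier ∧ DifferentiableOn ℂ (u n) (Metric.ball 0 R)) →
    DifferentiableOn ℂ f (Metric.ball 0 R) →
    (∀ Kc : Set ℂ, Kc ⊆ Metric.ball (0:ℂ) R → IsCompact Kc →
      TendstoUniformlyOn (fun n => u n) f Filter.atTop Kc) →
    f ∈ carrier ∧ Filter.Tendsto (fun n => nrm (u n - f)) Filter.atTop (nhds 0)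
  dilation_bound : ∃ C > (0:ℝ), ∀ f ∈ carrier, ∀ ζ : ℂ, ‖ζ‖ ≤ 1 →
    (fun z => f (ζ * z)) ∈ carrier ∧ nrm (fun z => f (ζ * z)) ≤ C * nrm f

/-- The operator `T_p = I^{ν_{1/p-2}}`. -/
def TpOp (p : ℝ) (g : ℂ → ℂ) : ℂ → ℂ :=
  fun z => ∑' k : ℕ,
    taylorCoeff g k * ((momentW (nuWeight (1 / p - 2)) (2 * (k:ℝ) + 1) : ℝ) : ℂ) * z ^ k

/-- Membership in the Bloch space. -/
def InBloch (g : ℂ → ℂ) : Prop :=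
  DifferentiableOn ℂ g (Metric.ball 0 1) ∧ BlochNormE g < ⊤

open Classical in
/-- The norm of the space `X_p = T_p(B)`, normed so that `T_p` is an isometry. -/
def XpNormE (p : ℝ) (h : ℂ → ℂ) : ℝ≥0∞ :=
  if H : ∃ g : ℂ → ℂ, InBloch g ∧ Set.EqOn h (TpOp p g) (Metric.ball 0 1)
  then BlochNormE H.choose else ⊤

/-- The polynomial `V_n ∗ g` where `V_n(z) = ∑_{j=2^{n-1}}^{2^{n+1}-1} ψ(j/2^{n-1}) z^j`
and `ψ(t) = Ψ(t/2) - Ψ(t)`. -/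
def VnStar (Ψ : ℝ → ℝ) (n : ℕ) (g : ℂ → ℂ) : ℂ → ℂ :=
  fun z => ∑ j ∈ Finset.Icc (2 ^ (n - 1) : ℕ) (2 ^ (n + 1) - 1 : ℕ),
    (((Ψ ((j:ℝ) / 2 ^ n) - Ψ ((j:ℝ) / 2 ^ (n - 1))) : ℝ) : ℂ) * taylorCoeff g j * z ^ j

/-- `D^ω(V_n ∗ g)`, where `D^ω h(z) = ∑ ĥ(k) z^k/(2ω_{2k+1})`. -/
def DVnStar (Ψ : ℝ → ℝ) (ω : ℝ → ℝ) (n : ℕ) (g : ℂ → ℂ) : ℂ → ℂ :=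
  fun z => ∑ j ∈ Finset.Icc (2 ^ (n - 1) : ℕ) (2 ^ (n + 1) - 1 : ℕ),
    (((Ψ ((j:ℝ) / 2 ^ n) - Ψ ((j:ℝ) / 2 ^ (n - 1))) : ℝ) : ℂ) * taylorCoeff g j * z ^ j /
      (2 * ((momentW ω (2 * (j:ℝ) + 1) : ℝ) : ℂ))

/-- `J_ω(t) = ∫_0^t ds/(ω̂(s)(1-s))`. -/
def Jomega (ω : ℝ → ℝ) (t : ℝ) : ℝ := ∫ s in (0:ℝ)..t, 1 / (omegaHat ω s * (1 - s))

/-- The circle `ℝ / 2πℤ`. -/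
abbrev Torus : Type := AddCircle (2 * Real.pi)

instance instFactTwoPiPos : Fact (0 < 2 * Real.pi) := ⟨Real.two_pi_pos⟩

/-- The normalized Haar measure of the circle. -/
abbrev haarT : Measure Torus := AddCircle.haarAddCircle

/-- The character `x ↦ e^{ix}` of the circle. -/
def expT (x : Torus) : ℂ := (AddCircle.toCircle x : ℂ)

lemma continuous_expT : Continuous expT :=
  continuous_subtype_val.comp AddCircle.continuous_toCircle

@[simp] lemma norm_expT (x : Torus) : ‖expT x‖ = 1 := Circle.norm_coe _

lemma expT_add (x y : Torus) : expT (x + y) = expT x * expT y := by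
  simp [expT, AddCircle.toCircle_add]

lemma expT_neg (x : Torus) : expT (-x) = (starRingEnd ℂ) (expT x) := by
  rw [expT, AddCircle.toCircle_neg, Circle.coe_inv_eq_conj, expT]

lemma expT_coe (θ : ℝ) : expT (θ : Torus) = Complex.exp (θ * Complex.I) := by
  simp [expT, AddCircle.toCircle_apply_mk, Circle.coe_exp]

lemma integrable_haarT {E : Type*} [NormedAddCommGroup E] {f : Torus → E} (hf : Continuous f) :
    Integrable f haarT :=
  hf.integrable_of_hasCompactSupport (HasCompactSupport.of_compactSpace f)

lemma memLp_haarT {f : Torus → ℂ} (hf : Continuous f) (p : ℝ≥0∞) : MemLp f p haarT :=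
  hf.memLp_of_hasCompactSupport (HasCompactSupport.of_compactSpace f)

/-- The `L^p` norm of a continuous function on the circle. -/
def torusNorm (p : ℝ) (f : Torus → ℂ) : ℝ := (∫ x, ‖f x‖ ^ p ∂haarT) ^ (1 / p)

lemma torusNorm_nonneg (p : ℝ) (f : Torus → ℂ) : 0 ≤ torusNorm p f := by
  unfold torusNorm
  positivity

lemma torusNorm_rpow {p : ℝ} (hp : 0 < p) (f : Torus → ℂ) :
    torusNorm p f ^ p = ∫ x, ‖f x‖ ^ p ∂haarT := by
  unfold torusNorm
  rw [← Real.rpow_mul (by positivity), one_div_mul_cancel hp.ne', Real.rpow_one]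

lemma torusNorm_mono {p : ℝ} (hp : 0 < p) {f g : Torus → ℂ} (hg : Continuous g)
    (h : ∀ x, ‖f x‖ ≤ ‖g x‖) : torusNorm p f ≤ torusNorm p g := by
  unfold torusNorm
  refine Real.rpow_le_rpow (by positivity) ?_ (by positivity)
  refine integral_mono_of_nonneg (.of_forall fun x => by positivity)
    (integrable_haarT (hg.norm.rpow_const fun _ => Or.inr hp.le))
    (.of_forall fun x => Real.rpow_le_rpow (norm_nonneg _) (h x) hp.le)

lemma torusNorm_comp_measurePreserving {p : ℝ} {f : Torus → ℂ} (hf : Continuous f)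
    {φ : Torus → Torus}
    (hφ : MeasurePreserving φ haarT haarT) : torusNorm p (fun x => f (φ x)) = torusNorm p f := by
  unfold torusNorm
  congr 1
  conv_rhs => rw [← hφ.map_eq]
  rw [integral_map hφ.measurable.aemeasurable]
  exact (hf.norm.measurable.pow_const p).aestronglyMeasurable

lemma norm_integral_mul_le {p q : ℝ} (hpq : p.HolderConjugate q) {f g : Torus → ℂ}
    (hf : Continuous f) (hg : Continuous g) :
    ‖∫ x, f x * g x ∂haarT‖ ≤ torusNorm p f * torusNorm q g := by
  refine (norm_integral_le_integral_norm _).trans ?_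
  simp_rw [norm_mul]
  exact integral_mul_norm_le_Lp_mul_Lq hpq (memLp_haarT hf _) (memLp_haarT hg _)

/-- The map `z ↦ conj z |z|^{p-2}`. -/
def dualMap (p : ℝ) (z : ℂ) : ℂ := (starRingEnd ℂ) z * ((‖z‖ ^ (p - 2) : ℝ) : ℂ)

lemma norm_dualMap {p : ℝ} (hp : 1 < p) (z : ℂ) : ‖dualMap p z‖ = ‖z‖ ^ (p - 1) := by
  rcases eq_or_ne z 0 with rfl | hz
  · simp [dualMap, Real.zero_rpow (sub_pos.2 hp).ne']
  · have := norm_pos_iff.2 hz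
    rw [dualMap, norm_mul, Complex.norm_real, RCLike.norm_conj, Real.norm_of_nonneg (by positivity),
      show p - 1 = 1 + (p - 2) by ring, Real.rpow_add this, Real.rpow_one]

lemma mul_dualMap {p : ℝ} (hp : 1 < p) (z : ℂ) : z * dualMap p z = ((‖z‖ ^ p : ℝ) : ℂ) := by
  rcases eq_or_ne z 0 with rfl | hz
  · simp [dualMap, Real.zero_rpow (by linarith : p ≠ 0)]
  · have := norm_pos_iff.2 hz
    rw [dualMap, ← mul_assoc, Complex.mul_conj, Complex.normSq_eq_norm_sq, ← Complex.ofReal_mul]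
    congr 1
    rw [← Real.rpow_natCast, ← Real.rpow_add this]
    norm_num

lemma continuous_dualMap {p : ℝ} (hp : 1 < p) : Continuous (dualMap p) := by
  rw [continuous_iff_continuousAt]
  intro z
  rcases eq_or_ne z 0 with rfl | hz
  · have h0 : dualMap p 0 = 0 := by simp [dualMap]
    rw [ContinuousAt, h0, tendsto_zero_iff_norm_tendsto_zero]
    simp_rw [norm_dualMap hp]
    have : Continuous fun z : ℂ => ‖z‖ ^ (p - 1) :=
      continuous_norm.rpow_const fun _ => Or.inr (sub_pos.2 hp).le
    have h := this.tendsto 0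
    rwa [norm_zero, Real.zero_rpow (sub_pos.2 hp).ne'] at h
  · refine ContinuousAt.mul Complex.continuous_conj.continuousAt ?_
    exact Complex.continuous_ofReal.continuousAt.comp
      (continuous_norm.continuousAt.rpow_const (Or.inl (norm_ne_zero_iff.2 hz)))

lemma torusNorm_dualMap {p q : ℝ} (hpq : p.HolderConjugate q) (F : Torus → ℂ) :
    torusNorm q (fun x => dualMap p (F x)) = (∫ x, ‖F x‖ ^ p ∂haarT) ^ (1 / q) := by
  unfold torusNorm
  simp_rw [norm_dualMap hpq.lt, ← Real.rpow_mul (norm_nonneg _), hpq.sub_one_mul_conj]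

/-- Converse of the Hölder inequality for continuous functions. -/
lemma torusNorm_le_of_dual {p q : ℝ} (hpq : p.HolderConjugate q) {F : Torus → ℂ}
    (hF : Continuous F) {B : ℝ} (hB : 0 ≤ B)
    (h : ∀ g : Torus → ℂ, Continuous g → ‖∫ x, F x * g x ∂haarT‖ ≤ B * torusNorm q g) :
    torusNorm p F ≤ B := by
  have h1 := h _ ((continuous_dualMap hpq.lt).comp hF)
  simp only [Function.comp_apply, mul_dualMap hpq.lt, integral_complex_ofReal, Complex.norm_real] at h1
  have hq := torusNorm_dualMap hpq F
  simp only [Function.comp_def] at h1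
  rw [hq] at h1
  unfold torusNorm
  set I := ∫ x, ‖F x‖ ^ p ∂haarT with hI
  have hI0 : 0 ≤ I := by positivity
  rcases hI0.eq_or_lt with h0 | h0
  · rw [← h0, Real.zero_rpow (by have := hpq.pos; positivity)]; exact hB
  · rw [Real.norm_of_nonneg hI0] at h1
    have h2 : I = I ^ (1 / p) * I ^ (1 / q) := by
      rw [← Real.rpow_add h0, one_div, one_div, hpq.inv_add_inv_eq_one, Real.rpow_one]
    nth_rw 1 [h2] at h1
    exact le_of_mul_le_mul_right h1 (by positivity)

lemma integral_haarT_swap {F : Torus → Torus → ℂ} (hF : Continuous (Function.uncurry F)) :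
    ∫ x, ∫ y, F x y ∂haarT ∂haarT = ∫ y, ∫ x, F x y ∂haarT ∂haarT :=
  integral_integral_swap
    (hF.integrable_of_hasCompactSupport (HasCompactSupport.of_compactSpace _))

lemma continuous_integral_haarT {Y E : Type*} [TopologicalSpace Y] [FirstCountableTopology Y]
    [LocallyCompactSpace Y] [NormedAddCommGroup E] [NormedSpace ℝ E]
    {F : Y → Torus → E} (hF : Continuous (Function.uncurry F)) :
    Continuous fun x => ∫ y, F x y ∂haarT := by
  have := continuous_parametric_integral_of_continuous (μ := haarT) hF isCompact_univ
  simpa using this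

lemma integral_haarT_sub_left (f : Torus → ℂ) (x : Torus) :
    ∫ y, f (x - y) ∂haarT = ∫ y, f y ∂haarT := integral_sub_left_eq_self f haarT x

lemma ContinuousOn.aestronglyMeasurable_comp_of_ae_mem {Y : Type*} [MeasurableSpace Y]
    {ν : Measure Y} {U : Set ℂ} (hU : MeasurableSet U) {M : ℂ → ℂ} (hM : ContinuousOn M U)
    {ψ : Y → ℂ} (hψ : AEStronglyMeasurable ψ ν) (hmem : ∀ᵐ y ∂ν, ψ y ∈ U) :
    AEStronglyMeasurable (fun y => M (ψ y)) ν := by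
  classical
  have h1 : Measurable (U.piecewise M 0) :=
    hM.measurable_piecewise continuousOn_const hU
  refine (h1.comp_aemeasurable hψ.aemeasurable).aestronglyMeasurable.congr ?_
  filter_upwards [hmem] with y hy
  exact Set.piecewise_eq_of_mem _ _ _ hy

/-- Holomorphy of `z ↦ ∫ φ(y) M(z ψ(y)) dν(y)` on the unit disc. -/
lemma differentiableOn_integral_mul_comp {Y : Type*} [MeasurableSpace Y] {ν : Measure Y}
    {M : ℂ → ℂ} (hM : DifferentiableOn ℂ M (Metric.ball 0 1)) {φ ψ : Y → ℂ} (hφ : Integrable φ ν)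
    (hψ : AEStronglyMeasurable ψ ν) (hψ1 : ∀ᵐ y ∂ν, ‖ψ y‖ ≤ 1) :
    (∀ z ∈ Metric.ball (0 : ℂ) 1, Integrable (fun y => φ y * M (z * ψ y)) ν) ∧
    DifferentiableOn ℂ (fun z => ∫ y, φ y * M (z * ψ y) ∂ν) (Metric.ball 0 1) := by
  have hmem : ∀ z ∈ Metric.ball (0 : ℂ) 1, ∀ᵐ y ∂ν, z * ψ y ∈ Metric.ball (0 : ℂ) 1 := by
    intro z hz
    filter_upwards [hψ1] with y hy
    rw [mem_ball_zero_iff] at hz ⊢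
    rw [norm_mul]
    nlinarith [norm_nonneg z, norm_nonneg (ψ y)]
  have hmeas : ∀ N : ℂ → ℂ, ContinuousOn N (Metric.ball 0 1) → ∀ z ∈ Metric.ball (0 : ℂ) 1,
      AEStronglyMeasurable (fun y => N (z * ψ y)) ν := fun N hN z hz =>
    hN.aestronglyMeasurable_comp_of_ae_mem measurableSet_ball (hψ.const_mul z) (hmem z hz)
  have hbdd : ∀ N : ℂ → ℂ, ContinuousOn N (Metric.ball 0 1) → ∀ R < (1 : ℝ),
      ∃ K, ∀ z ∈ Metric.ball (0 : ℂ) R,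
      ∀ᵐ y ∂ν, ‖N (z * ψ y)‖ ≤ K := by
    intro N hN R hR
    obtain ⟨K, hK⟩ := (isCompact_closedBall (0 : ℂ) R).exists_bound_of_continuousOn
      (hN.mono (Metric.closedBall_subset_ball hR))
    refine ⟨K, fun z hz => ?_⟩
    filter_upwards [hψ1] with y hy
    refine hK _ ?_
    rw [mem_ball_zero_iff] at hz
    rw [mem_closedBall_zero_iff, norm_mul]
    nlinarith [norm_nonneg z, norm_nonneg (ψ y)]
  have hM' : ContinuousOn (deriv M) (Metric.ball 0 1) := (hM.deriv Metric.isOpen_ball).continuousOn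
  have hint : ∀ z ∈ Metric.ball (0 : ℂ) 1, Integrable (fun y => φ y * M (z * ψ y)) ν := by
    intro z hz
    rw [mem_ball_zero_iff] at hz
    obtain ⟨R, hzR, hR⟩ := exists_between hz
    obtain ⟨K, hK⟩ := hbdd M hM.continuousOn R hR
    exact hφ.mul_bdd (c := K) (hmeas M hM.continuousOn z (by simpa using hz)) (hK z
      (by simpa using hzR))
  refine ⟨hint, fun z hz => ?_⟩
  have hz' := hz
  rw [mem_ball_zero_iff] at hz'
  obtain ⟨R, hzR, hR⟩ := exists_between hz'
  obtain ⟨K, hK⟩ := (isCompact_closedBall (0 : ℂ) R).exists_bound_of_continuousOn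
      (hM'.mono (Metric.closedBall_subset_ball hR))
  have hsub : Metric.ball (0 : ℂ) R ⊆ Metric.ball 0 1 := Metric.ball_subset_ball hR.le
  have hK0 : 0 ≤ K := (norm_nonneg _).trans (hK z (by simpa using hzR.le))
  refine ((hasDerivAt_integral_of_dominated_loc_of_deriv_le (μ := ν) (s := Metric.ball (0 : ℂ) R)
    (F := fun z y => φ y * M (z * ψ y))
    (F' := fun z y => φ y * (deriv M (z * ψ y) * ψ y)) (bound := fun y => ‖φ y‖ * K)
    (Metric.isOpen_ball.mem_nhds (by simpa using hzR)) ?_ (hint z hz) ?_ ?_ (hφ.norm.mul_const K)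
    ?_).2.differentiableAt).differentiableWithinAt
  · filter_upwards [Metric.isOpen_ball.mem_nhds hz] with w hw
    exact (hint w hw).aestronglyMeasurable
  · exact hφ.aestronglyMeasurable.mul ((hmeas _ hM' z hz).mul hψ)
  · filter_upwards [hψ1] with y hy w hw
    rw [norm_mul, norm_mul]
    rw [mem_ball_zero_iff] at hw
    have := hK (w * ψ y) (by
      rw [mem_closedBall_zero_iff, norm_mul]
      nlinarith [norm_nonneg w, norm_nonneg (ψ y)])
    gcongr
    nlinarith [norm_nonneg (ψ y), norm_nonneg (deriv M (w * ψ y))]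
  · filter_upwards [hψ1] with y hy w hw
    rw [mem_ball_zero_iff] at hw
    have hmem : w * ψ y ∈ Metric.ball (0 : ℂ) 1 := by
      rw [mem_ball_zero_iff, norm_mul]
      nlinarith [norm_nonneg w, norm_nonneg (ψ y)]
    have h1 := (hM.differentiableAt (Metric.isOpen_ball.mem_nhds hmem)).hasDerivAt
    have h2 : HasDerivAt (fun w : ℂ => w * ψ y) (ψ y) w := by
      simpa using (hasDerivAt_id w).mul_const (ψ y)
    exact (h1.comp w h2).const_mul (φ y)

lemma ofReal_mul_expT_mem_ball {r : ℝ} (hr : r ∈ Ico (0 : ℝ) 1) (x : Torus) :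
    (r : ℂ) * expT x ∈ Metric.ball (0 : ℂ) 1 := by
  simpa [abs_of_nonneg hr.1] using hr.2

/-- Mean value property on the circle of radius `r`. -/
lemma integral_comp_mul_expT {M : ℂ → ℂ} (hM : DifferentiableOn ℂ M (Metric.ball 0 1))
    {r : ℝ} (hr : r ∈ Ico (0 : ℝ) 1) : ∫ x, M (r * expT x) ∂haarT = M 0 := by
  have h : DiffContOnCl ℂ M (Metric.ball 0 |r|) := by
    rw [abs_of_nonneg hr.1]
    refine DifferentiableOn.diffContOnCl_ball (U := Metric.ball 0 1) hM ?_
    exact Metric.closedBall_subset_ball hr.2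
  rw [← h.circleAverage, Real.circleAverage, AddCircle.integral_haarAddCircle,
    ← AddCircle.intervalIntegral_preimage _ 0]
  simp [expT_coe, circleMap]

/-- The Herglotz kernel. -/
def herglotz (w : ℂ) : ℂ := (1 + w) / (1 - w)

lemma one_sub_ne_zero_of_mem_ball {w : ℂ} (hw : w ∈ Metric.ball (0 : ℂ) 1) : 1 - w ≠ 0 := by
  rintro h
  rw [← sub_eq_zero.1 h] at hw
  simp at hw

lemma differentiableOn_herglotz : DifferentiableOn ℂ herglotz (Metric.ball 0 1) := by
  unfold herglotz
  exact DifferentiableOn.div (by fun_prop) (by fun_prop) fun w hw => one_sub_ne_zero_of_mem_ball hw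

lemma herglotz_re_pos {w : ℂ} (hw : w ∈ Metric.ball (0 : ℂ) 1) : 0 < (herglotz w).re := by
  have h1 := one_sub_ne_zero_of_mem_ball hw
  have h2 : (herglotz w).re = (1 - ‖w‖ ^ 2) / Complex.normSq (1 - w) := by
    rw [herglotz, Complex.div_re, ← add_div, ← Complex.normSq_eq_norm_sq, Complex.normSq_apply w]
    congr 1
    simp
    ring
  rw [h2]
  rw [mem_ball_zero_iff] at hw
  exact div_pos (by nlinarith [norm_nonneg w]) (Complex.normSq_pos.2 h1)

lemma continuous_comp_mul_expT {M : ℂ → ℂ} (hM : ContinuousOn M (Metric.ball 0 1))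
    {r : ℝ} (hr : r ∈ Ico (0 : ℝ) 1) {Y : Type*} [TopologicalSpace Y]
    {φ : Y → Torus} (hφ : Continuous φ) : Continuous fun y => M (r * expT (φ y)) :=
  hM.comp_continuous (continuous_const.mul (continuous_expT.comp hφ))
    fun y => ofReal_mul_expT_mem_ball hr (φ y)

/-- Convolution with a probability density contracts the `L^p` norm. -/
lemma torusNorm_conv_le {p q : ℝ} (hpq : p.HolderConjugate q) {k : Torus → ℝ} (hk : Continuous k)
    (hk0 : ∀ x, 0 ≤ k x) (hk1 : ∫ x, k x ∂haarT = 1) {g : Torus → ℂ} (hg : Continuous g) :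
    torusNorm p (fun x => ∫ y, g y * (k (x - y) : ℂ) ∂haarT) ≤ torusNorm p g := by
  have hc : Continuous fun x => ∫ y, g y * (k (x - y) : ℂ) ∂haarT := by
    refine continuous_integral_haarT ?_
    fun_prop
  refine torusNorm_le_of_dual hpq hc (torusNorm_nonneg _ _) fun h hh => ?_
  have h1 : ∀ x, ∫ y, g y * (k (x - y) : ℂ) ∂haarT = ∫ u, g (x - u) * (k u : ℂ) ∂haarT := by
    intro x
    rw [← integral_haarT_sub_left (fun y => g y * (k (x - y) : ℂ)) x]
    simp
  simp_rw [h1, ← integral_mul_const]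
  rw [integral_haarT_swap (by fun_prop)]
  have h2 : ∀ u, ∫ x, g (x - u) * (k u : ℂ) * h x ∂haarT
      = (k u : ℂ) * ∫ x, g (x - u) * h x ∂haarT := by
    intro u
    rw [← integral_const_mul]
    congr 1; ext x; ring
  simp_rw [h2]
  calc _ ≤ ∫ u, ‖(k u : ℂ) * ∫ x, g (x - u) * h x ∂haarT‖ ∂haarT := norm_integral_le_integral_norm _
    _ ≤ ∫ u, k u * (torusNorm p g * torusNorm q h) ∂haarT := by
      refine integral_mono_of_nonneg (.of_forall fun _ => norm_nonneg _)
        (integrable_haarT (by fun_prop)) (.of_forall fun u => ?_)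
      simp only [norm_mul, Complex.norm_real, Real.norm_of_nonneg (hk0 u)]
      refine mul_le_mul_of_nonneg_left ?_ (hk0 u)
      have h3 := norm_integral_mul_le hpq (f := fun x => g (x - u)) (by fun_prop) hh
      rwa [torusNorm_comp_measurePreserving hg (measurePreserving_sub_right haarT u)] at h3
    _ = _ := by rw [integral_mul_const, hk1, one_mul]

/-- The pointwise inequality behind the M. Riesz theorem. -/
lemma exists_norm_rpow_le_re {p : ℝ} (hp : 1 < p) (hp2 : p ≤ 2) :
    ∃ A > 0, ∃ B > 0, ∀ w : ℂ, 0 < w.re →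
      ‖w‖ ^ p ≤ A * w.re ^ p - B * (w ^ (p : ℂ)).re := by
  have hpi := Real.pi_pos
  set a : ℝ := (Real.pi / (2 * p) + Real.pi / 2) / 2 with ha
  have h1 : Real.pi / (2 * p) < Real.pi / 2 :=
    div_lt_div_of_pos_left hpi (by norm_num) (by linarith)
  have h0 : 0 < Real.pi / (2 * p) := by positivity
  have ha0 : 0 < a := by rw [ha]; linarith
  have ha1 : a < Real.pi / 2 := by rw [ha]; linarith
  have hpa : Real.pi / 2 < p * a := by
    have : Real.pi / (2 * p) < a := by rw [ha]; linarith
    calc Real.pi / 2 = p * (Real.pi / (2 * p)) := by field_simp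
      _ < p * a := by gcongr
  have hpa' : p * a ≤ Real.pi := by nlinarith
  have hcosa : 0 < Real.cos a := Real.cos_pos_of_mem_Ioo ⟨by linarith, ha1⟩
  have hcospa : Real.cos (p * a) < 0 :=
    Real.cos_neg_of_pi_div_two_lt_of_lt hpa (by linarith)
  set B : ℝ := -(Real.cos (p * a))⁻¹ with hB
  have hB0 : 0 < B := by rw [hB, neg_pos]; exact inv_lt_zero.2 hcospa
  refine ⟨(1 + B) / Real.cos a ^ p, by positivity, B, hB0, fun w hw => ?_⟩
  have hw0 : w ≠ 0 := by rintro rfl; simp at hw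
  have hn : 0 < ‖w‖ := norm_pos_iff.2 hw0
  have harg : |w.arg| < Real.pi / 2 := Complex.abs_arg_lt_pi_div_two_iff.2 (Or.inl hw)
  have hre : w.re = ‖w‖ * Real.cos |w.arg| := by
    rw [Real.cos_abs]; exact (Complex.norm_mul_cos_arg w).symm
  have hpow : (w ^ (p : ℂ)).re = ‖w‖ ^ p * Real.cos (p * |w.arg|) := by
    have h3 : Real.cos (p * |w.arg|) = Real.cos (w.arg * p) := by
      rw [← Real.cos_abs (w.arg * p), abs_mul, abs_of_pos (by linarith : 0 < p), mul_comm]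
    rw [Complex.cpow_ofReal, h3, Complex.re_ofReal_mul]
    congr 1
    simp only [Complex.add_re, Complex.mul_re, Complex.ofReal_re, Complex.ofReal_im,
      Complex.I_re, Complex.I_im]
    ring
  have hcos : 0 ≤ Real.cos |w.arg| :=
    Real.cos_nonneg_of_mem_Icc ⟨by linarith [abs_nonneg w.arg], harg.le⟩
  rw [hpow, hre, Real.mul_rpow hn.le hcos]
  suffices h : 1 ≤ (1 + B) / Real.cos a ^ p * Real.cos |w.arg| ^ p - B * Real.cos (p * |w.arg|) by
    have := mul_le_mul_of_nonneg_left h (Real.rpow_nonneg hn.le p)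
    linarith
  rcases le_total |w.arg| a with hle | hle
  · have h4 : Real.cos a ^ p ≤ Real.cos |w.arg| ^ p := by
      refine Real.rpow_le_rpow hcosa.le ?_ (by linarith)
      exact Real.cos_le_cos_of_nonneg_of_le_pi (abs_nonneg _) (by linarith) hle
    have h5 : 1 + B ≤ (1 + B) / Real.cos a ^ p * Real.cos |w.arg| ^ p := by
      rw [div_mul_eq_mul_div, le_div_iff₀ (by positivity)]
      gcongr
    nlinarith [Real.cos_le_one (p * |w.arg|)]
  · have h4 : Real.cos (p * |w.arg|) ≤ Real.cos (p * a) := by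
      refine Real.cos_le_cos_of_nonneg_of_le_pi (by positivity) ?_ (by gcongr)
      nlinarith
    have h5 : 1 ≤ - (B * Real.cos (p * |w.arg|)) := by
      have : 1 = - (B * Real.cos (p * a)) := by
        rw [hB, neg_mul, neg_neg, inv_mul_cancel₀ hcospa.ne]
      rw [this]
      gcongr
    have h6 : 0 ≤ (1 + B) / Real.cos a ^ p * Real.cos |w.arg| ^ p := by positivity
    linarith

lemma differentiableOn_one_sub_inv :
    DifferentiableOn ℂ (fun w : ℂ => (1 - w)⁻¹) (Metric.ball 0 1) :=
  DifferentiableOn.inv (by fun_prop) fun _ hw => one_sub_ne_zero_of_mem_ball hw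

/-- The Herglotz transform of a nonnegative continuous function is bounded in `L^p` for
`1 < p ≤ 2`. -/
lemma exists_torusNorm_herglotz_le {p q : ℝ} (hpq : p.HolderConjugate q) (hp2 : p ≤ 2) :
    ∃ A > 0, ∀ r ∈ Ico (0 : ℝ) 1, ∀ g : Torus → ℝ, Continuous g → (∀ x, 0 ≤ g x) →
      torusNorm p (fun x => ∫ y, (g y : ℂ) * herglotz (r * expT (x - y)) ∂haarT)
        ≤ A * torusNorm p (fun x => (g x : ℂ)) := by
  obtain ⟨A, hA, B, hB, hAB⟩ := exists_norm_rpow_le_re hpq.lt hp2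
  refine ⟨A ^ (1 / p), by positivity, fun r hr g hg hg0 => ?_⟩
  have hp0 : 0 < p := hpq.pos
  by_cases hz : ∃ x, g x ≠ 0
  swap
  · push Not at hz
    have : torusNorm p (fun x => (0 : ℂ)) = 0 := by
      simp [torusNorm, Real.zero_rpow hp0.ne', Real.zero_rpow (inv_pos.2 hp0).ne']
    simp [hz, this]
  obtain ⟨x₀, hx₀⟩ := hz
  set G : ℂ → ℂ := fun z => ∫ y, (g y : ℂ) * herglotz (z * expT (-y)) ∂haarT with hG
  have hgC : Continuous fun x => (g x : ℂ) := Complex.continuous_ofReal.comp hg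
  have hψ : Continuous fun y : Torus => expT (-y) := continuous_expT.comp continuous_neg
  obtain ⟨hint, hdiff⟩ := differentiableOn_integral_mul_comp (ν := haarT) differentiableOn_herglotz
    (integrable_haarT hgC) hψ.aestronglyMeasurable (.of_forall fun y => (norm_expT _).le)
  have hmem : ∀ z ∈ Metric.ball (0 : ℂ) 1, ∀ y : Torus, z * expT (-y) ∈ Metric.ball (0 : ℂ) 1 := by
    intro z hz y
    simpa using hz
  have hre : ∀ z ∈ Metric.ball (0 : ℂ) 1,
      (G z).re = ∫ y, g y * (herglotz (z * expT (-y))).re ∂haarT := by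
    intro z hz
    have := integral_re (hint z hz)
    simp only [RCLike.re_eq_complex_re, Complex.re_ofReal_mul] at this
    exact this.symm
  have hpos : ∀ z ∈ Metric.ball (0 : ℂ) 1, 0 < (G z).re := by
    intro z hz
    rw [hre z hz]
    have hc : Continuous fun y => g y * (herglotz (z * expT (-y))).re :=
      hg.mul (Complex.continuous_re.comp (differentiableOn_herglotz.continuousOn.comp_continuous
        (continuous_const.mul hψ) (hmem z hz)))
    refine Continuous.integral_pos_of_hasCompactSupport_nonneg_nonzero hc
      (HasCompactSupport.of_compactSpace _)
      (fun y => mul_nonneg (hg0 y) (herglotz_re_pos (hmem z hz y)).le) (x := x₀)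
      (mul_ne_zero hx₀ (herglotz_re_pos (hmem z hz x₀)).ne')
  have hG0 : G 0 = ((∫ y, g y ∂haarT : ℝ) : ℂ) := by
    simp [hG, herglotz, integral_complex_ofReal]
  have hGx : ∀ x, ∫ y, (g y : ℂ) * herglotz (r * expT (x - y)) ∂haarT = G (r * expT x) := by
    intro x
    simp only [hG, sub_eq_add_neg, expT_add, mul_assoc]
  have hpowd : DifferentiableOn ℂ (fun z => G z ^ (p : ℂ)) (Metric.ball 0 1) :=
    hdiff.cpow_const fun z hz => Or.inl (hpos z hz)
  have hmean := integral_comp_mul_expT hpowd hr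
  have hcpow := continuous_comp_mul_expT hpowd.continuousOn hr continuous_id
  have hcG := continuous_comp_mul_expT hdiff.continuousOn hr continuous_id
  simp only [id] at hcpow hcG
  have hmeanre : 0 ≤ ∫ x, ((G (r * expT x)) ^ (p : ℂ)).re ∂haarT := by
    have := integral_re (integrable_haarT hcpow)
    simp only [RCLike.re_eq_complex_re] at this
    have hI : 0 ≤ ∫ y, g y ∂haarT := integral_nonneg hg0
    rw [this, hmean, hG0, ← Complex.ofReal_cpow hI, Complex.ofReal_re]
    exact Real.rpow_nonneg hI p
  have hcre : Continuous fun x => (G (r * expT x)).re ^ p :=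
    (Complex.continuous_re.comp hcG).rpow_const fun _ => Or.inr hp0.le
  have h1 : ∫ x, ‖G (r * expT x)‖ ^ p ∂haarT ≤ A * ∫ x, (G (r * expT x)).re ^ p ∂haarT := by
    calc _ ≤ ∫ x, (A * (G (r * expT x)).re ^ p - B * ((G (r * expT x)) ^ (p : ℂ)).re) ∂haarT := by
          refine integral_mono_of_nonneg (.of_forall fun _ => by positivity)
            (integrable_haarT ?_) (.of_forall fun x => hAB _ (hpos _
              (ofReal_mul_expT_mem_ball hr x)))
          exact (continuous_const.mul hcre).sub (continuous_const.mul
            (Complex.continuous_re.comp hcpow))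
      _ = A * ∫ x, (G (r * expT x)).re ^ p ∂haarT
          - B * ∫ x, ((G (r * expT x)) ^ (p : ℂ)).re ∂haarT := by
          rw [integral_sub, integral_const_mul, integral_const_mul]
          · exact (integrable_haarT hcre).const_mul A
          · exact (integrable_haarT (Complex.continuous_re.comp hcpow)).const_mul B
      _ ≤ _ := by nlinarith
  have h2 : torusNorm p (fun x => ((G (r * expT x)).re : ℂ))
      ≤ torusNorm p (fun x => (g x : ℂ)) := by
    have hk : Continuous fun x => (herglotz (r * expT x)).re :=
      Complex.continuous_re.comp
        (continuous_comp_mul_expT differentiableOn_herglotz.continuousOn hr continuous_id)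
    have hk1 : ∫ x, (herglotz (r * expT x)).re ∂haarT = 1 := by
      have h3 := integral_re (integrable_haarT
        (continuous_comp_mul_expT differentiableOn_herglotz.continuousOn hr continuous_id))
      simp only [RCLike.re_eq_complex_re, id] at h3
      rw [h3, integral_comp_mul_expT differentiableOn_herglotz hr]
      simp [herglotz]
    have h4 := torusNorm_conv_le hpq hk
      (fun x => (herglotz_re_pos (ofReal_mul_expT_mem_ball hr x)).le) hk1 hgC
    convert h4 using 3 with x
    rw [hre _ (ofReal_mul_expT_mem_ball hr x), ← integral_complex_ofReal]
    congr 1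
    ext y
    rw [sub_eq_add_neg, expT_add, mul_assoc, Complex.ofReal_mul]
  simp_rw [hGx]
  have h5 : ∫ x, (G (r * expT x)).re ^ p ∂haarT ≤ torusNorm p (fun x => (g x : ℂ)) ^ p := by
    have h6 := Real.rpow_le_rpow (torusNorm_nonneg _ _) h2 hp0.le
    rw [torusNorm_rpow hp0] at h6
    convert h6 using 3 with x
    rw [Complex.norm_real, Real.norm_of_nonneg (hpos _ (ofReal_mul_expT_mem_ball hr x)).le]
  calc torusNorm p (fun x => G (r * expT x))
      ≤ (A * torusNorm p (fun x => (g x : ℂ)) ^ p) ^ (1 / p) := by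
        rw [torusNorm]
        exact Real.rpow_le_rpow (by positivity) (h1.trans (by gcongr)) (by positivity)
    _ = _ := by
        rw [Real.mul_rpow hA.le (Real.rpow_nonneg (torusNorm_nonneg _ _) _),
          ← Real.rpow_mul (torusNorm_nonneg _ _), mul_one_div_cancel hp0.ne', Real.rpow_one]

/-- The bilinear form of the convolution with `x ↦ M(r e^{ix})`. -/
def convForm (M : ℂ → ℂ) (r : ℝ) (g h : Torus → ℂ) : ℂ :=
  ∫ x, (∫ y, g y * M (r * expT (x - y)) ∂haarT) * h x ∂haarT

lemma continuous_conv {M : ℂ → ℂ} (hM : ContinuousOn M (Metric.ball 0 1)) {r : ℝ}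
    (hr : r ∈ Ico (0 : ℝ) 1) {g : Torus → ℂ} (hg : Continuous g) :
    Continuous fun x => ∫ y, g y * M (r * expT (x - y)) ∂haarT := by
  refine continuous_integral_haarT ?_
  exact (hg.comp continuous_snd).mul
    (continuous_comp_mul_expT hM hr (continuous_fst.sub continuous_snd))

lemma convForm_add_left {M : ℂ → ℂ} (hM : ContinuousOn M (Metric.ball 0 1)) {r : ℝ}
    (hr : r ∈ Ico (0 : ℝ) 1) {g₁ g₂ h : Torus → ℂ} (hg₁ : Continuous g₁) (hg₂ : Continuous g₂)
    (hh : Continuous h) :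
    convForm M r (fun x => g₁ x + g₂ x) h = convForm M r g₁ h + convForm M r g₂ h := by
  unfold convForm
  have hk : ∀ x, Continuous fun y => M (r * expT (x - y)) := fun x =>
    continuous_comp_mul_expT hM hr (continuous_const.sub continuous_id)
  refine Eq.trans ?_ (integral_add (integrable_haarT ((continuous_conv hM hr hg₁).mul hh))
    (integrable_haarT ((continuous_conv hM hr hg₂).mul hh)))
  congr 1; ext x
  refine Eq.trans ?_ (add_mul _ _ _)
  refine congrArg (· * h x) (Eq.trans ?_ (integral_add (integrable_haarT (hg₁.mul (hk x)))
    (integrable_haarT (hg₂.mul (hk x)))))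
  congr 1; ext y
  exact add_mul _ _ _

lemma convForm_const_mul_left (M : ℂ → ℂ) (r : ℝ) (c : ℂ) (g h : Torus → ℂ) :
    convForm M r (fun x => c * g x) h = c * convForm M r g h := by
  unfold convForm
  simp_rw [mul_assoc, integral_const_mul, mul_assoc]
  rw [integral_const_mul]

/-- Swapping the two functions in the bilinear form amounts to a reflection. -/
lemma convForm_swap {M : ℂ → ℂ} (hM : ContinuousOn M (Metric.ball 0 1)) {r : ℝ}
    (hr : r ∈ Ico (0 : ℝ) 1) {g h : Torus → ℂ} (hg : Continuous g) (hh : Continuous h) :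
    convForm M r g h = convForm M r (fun x => h (-x)) (fun x => g (-x)) := by
  unfold convForm
  simp_rw [← integral_mul_const]
  rw [integral_haarT_swap (F := fun x y => g y * M (r * expT (x - y)) * h x)
    (((hg.comp continuous_snd).mul (continuous_comp_mul_expT hM hr
      (continuous_fst.sub continuous_snd))).mul (hh.comp continuous_fst))]
  rw [← integral_neg_eq_self]
  congr 1; ext x
  rw [← integral_neg_eq_self]
  congr 1; ext y
  rw [show -y - -x = x - y by abel]
  ring

lemma norm_integral_le_torusNorm {p q : ℝ} (hpq : p.HolderConjugate q) {f : Torus → ℂ}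
    (hf : Continuous f) : ‖∫ x, f x ∂haarT‖ ≤ torusNorm p f := by
  have := norm_integral_mul_le hpq hf (continuous_const (y := (1 : ℂ)))
  have h1 : torusNorm q (fun _ => (1 : ℂ)) = 1 := by simp [torusNorm]
  simpa [h1] using this

/-- The M. Riesz theorem for `1 < p ≤ 2`. -/
lemma exists_norm_convForm_le_of_le_two {p q : ℝ} (hpq : p.HolderConjugate q) (hp2 : p ≤ 2) :
    ∃ A > 0, ∀ r ∈ Ico (0 : ℝ) 1, ∀ g h : Torus → ℂ, Continuous g → Continuous h →
      ‖convForm (fun w => (1 - w)⁻¹) r g h‖ ≤ A * (torusNorm p g * torusNorm q h) := by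
  obtain ⟨A, hA, hAG⟩ := exists_torusNorm_herglotz_le hpq hp2
  set Q : ℂ → ℂ := fun w => (1 - w)⁻¹ with hQ
  have hQc : ContinuousOn Q (Metric.ball 0 1) := differentiableOn_one_sub_inv.continuousOn
  have hpos : ∀ r ∈ Ico (0 : ℝ) 1, ∀ (g : Torus → ℝ) (h : Torus → ℂ), Continuous g →
      (∀ x, 0 ≤ g x) → Continuous h →
      ‖convForm Q r (fun x => (g x : ℂ)) h‖
        ≤ (A + 1) * (torusNorm p (fun x => (g x : ℂ)) * torusNorm q h) := by
    intro r hr g h hg hg0 hh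
    have hgC : Continuous fun x => (g x : ℂ) := Complex.continuous_ofReal.comp hg
    have hHc := differentiableOn_herglotz.continuousOn
    have hsplit : convForm Q r (fun x => (g x : ℂ)) h
        = (1 / 2) * (convForm herglotz r (fun x => (g x : ℂ)) h
          + (∫ y, (g y : ℂ) ∂haarT) * ∫ x, h x ∂haarT) := by
      unfold convForm
      have hsum := integral_add (integrable_haarT ((continuous_conv hHc hr hgC).mul hh))
        ((integrable_haarT hh).const_mul (∫ y, (g y : ℂ) ∂haarT))
      simp only [Pi.mul_apply] at hsum
      rw [← integral_const_mul, ← hsum, ← integral_const_mul]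
      congr 1; ext x
      rw [← add_mul, ← mul_assoc]
      congr 1
      have hk : Continuous fun y => herglotz (r * expT (x - y)) :=
        continuous_comp_mul_expT hHc hr (continuous_const.sub continuous_id)
      have hsum' := integral_add (integrable_haarT (hgC.mul hk)) (integrable_haarT hgC)
      simp only [Pi.mul_apply] at hsum'
      rw [← hsum', ← integral_const_mul]
      congr 1; ext y
      have := one_sub_ne_zero_of_mem_ball (ofReal_mul_expT_mem_ball hr (x - y))
      simp only [hQ, herglotz]
      field_simp
      ring
    have h1 : ‖convForm herglotz r (fun x => (g x : ℂ)) h‖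
        ≤ A * torusNorm p (fun x => (g x : ℂ)) * torusNorm q h :=
      (norm_integral_mul_le hpq (continuous_conv hHc hr hgC) hh).trans
        (mul_le_mul_of_nonneg_right (hAG r hr g hg hg0) (torusNorm_nonneg _ _))
    have h2 : ‖(∫ y, (g y : ℂ) ∂haarT) * ∫ x, h x ∂haarT‖
        ≤ torusNorm p (fun x => (g x : ℂ)) * torusNorm q h := by
      rw [norm_mul]
      exact mul_le_mul (norm_integral_le_torusNorm hpq hgC)
        (norm_integral_le_torusNorm hpq.symm hh) (norm_nonneg _) (torusNorm_nonneg _ _)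
    have h3 : 0 ≤ torusNorm p (fun x => (g x : ℂ)) * torusNorm q h :=
      mul_nonneg (torusNorm_nonneg _ _) (torusNorm_nonneg _ _)
    rw [hsplit, norm_mul]
    have h4 := norm_add_le (convForm herglotz r (fun x => (g x : ℂ)) h)
      ((∫ y, (g y : ℂ) ∂haarT) * ∫ x, h x ∂haarT)
    have h5 : ‖(1 / 2 : ℂ)‖ = 1 / 2 := by norm_num
    rw [h5]
    nlinarith [norm_nonneg (convForm herglotz r (fun x => (g x : ℂ)) h
      + (∫ y, (g y : ℂ) ∂haarT) * ∫ x, h x ∂haarT)]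
  refine ⟨4 * (A + 1), by positivity, fun r hr g h hg hh => ?_⟩
  have hpart : ∀ φ : ℂ → ℝ, Continuous φ → (∀ z, |φ z| ≤ ‖z‖) →
      ‖convForm Q r (fun x => ((max (φ (g x)) 0 : ℝ) : ℂ)) h‖
        ≤ (A + 1) * (torusNorm p g * torusNorm q h) := by
    intro φ hφ hle
    refine (hpos r hr (fun x => max (φ (g x)) 0) h (by fun_prop)
      (fun x => le_max_right _ _) hh).trans ?_
    refine mul_le_mul_of_nonneg_left (mul_le_mul_of_nonneg_right ?_ (torusNorm_nonneg _ _))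
      (by positivity)
    refine torusNorm_mono hpq.pos hg fun x => ?_
    rw [Complex.norm_real, Real.norm_of_nonneg (le_max_right _ _)]
    exact max_le ((le_abs_self _).trans (hle _)) (norm_nonneg _)
  have hdec : g = fun x => (((((max (g x).re 0 : ℝ) : ℂ) + (-1) * ((max (-(g x).re) 0 : ℝ) : ℂ))
      + Complex.I * ((max (g x).im 0 : ℝ) : ℂ)) + (-Complex.I) *
        ((max (-(g x).im) 0 : ℝ) : ℂ)) := by
    ext x
    have h1 : ∀ t : ℝ, t = max t 0 - max (-t) 0 := fun t => by
      rcases le_total t 0 with h | h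
      · rw [max_eq_right h, max_eq_left (by linarith)]; ring
      · rw [max_eq_left h, max_eq_right (by linarith)]; ring
    conv_lhs => rw [← Complex.re_add_im (g x), h1 (g x).re, h1 (g x).im]
    push_cast
    ring
  have e1 := hpart (fun z => z.re) (by fun_prop) Complex.abs_re_le_norm
  have e2 := hpart (fun z => -z.re) (by fun_prop)
    (fun z => by rw [abs_neg]; exact Complex.abs_re_le_norm z)
  have e3 := hpart (fun z => z.im) (by fun_prop) Complex.abs_im_le_norm
  have e4 := hpart (fun z => -z.im) (by fun_prop)
    (fun z => by rw [abs_neg]; exact Complex.abs_im_le_norm z)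
  conv_lhs => rw [hdec]
  rw [convForm_add_left hQc hr (by fun_prop) (by fun_prop) hh,
    convForm_add_left hQc hr (by fun_prop) (by fun_prop) hh,
    convForm_add_left hQc hr (by fun_prop) (by fun_prop) hh,
    convForm_const_mul_left, convForm_const_mul_left, convForm_const_mul_left]
  refine (norm_add₄_le).trans ?_
  simp only [norm_mul, norm_neg, norm_one, Complex.norm_I, one_mul]
  linarith

/-- The M. Riesz theorem for `1 < p < ∞`. -/
lemma exists_norm_convForm_le {p q : ℝ} (hpq : p.HolderConjugate q) :
    ∃ A > 0, ∀ r ∈ Ico (0 : ℝ) 1, ∀ g h : Torus → ℂ, Continuous g → Continuous h →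
      ‖convForm (fun w => (1 - w)⁻¹) r g h‖ ≤ A * (torusNorm p g * torusNorm q h) := by
  rcases le_total p 2 with hp | hp
  · exact exists_norm_convForm_le_of_le_two hpq hp
  · have hq : q ≤ 2 := by
      rw [hpq.conjugate_eq]
      rw [div_le_iff₀ (by linarith)]
      linarith
    obtain ⟨A, hA, h⟩ := exists_norm_convForm_le_of_le_two hpq.symm hq
    refine ⟨A, hA, fun r hr g k hg hk => ?_⟩
    rw [convForm_swap differentiableOn_one_sub_inv.continuousOn hr hg hk]
    refine (h r hr _ _ (hk.comp continuous_neg) (hg.comp continuous_neg)).trans_eq ?_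
    have hn : ∀ s (u : Torus → ℂ), Continuous u → torusNorm s (u ∘ fun a => -a) = torusNorm s u :=
      fun s u hu => torusNorm_comp_measurePreserving hu (Measure.measurePreserving_neg haarT)
    rw [hn _ _ hk, hn _ _ hg, mul_comm (torusNorm q k)]

lemma hasSum_convForm {N : ℕ → ℂ → ℂ} {M : ℂ → ℂ} {r : ℝ} (hr : r ∈ Ico (0 : ℝ) 1)
    (hN : ∀ j, ContinuousOn (N j) (Metric.ball 0 1))
    (hM : ∀ x, HasSum (fun j => N j (r * expT x)) (M (r * expT x)))
    {u : ℕ → ℝ} (hu : Summable u) (hNu : ∀ j x, ‖N j (r * expT x)‖ ≤ u j)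
    {g h : Torus → ℂ} (hg : Continuous g) (hh : Continuous h) :
    HasSum (fun j => convForm (N j) r g h) (convForm M r g h) := by
  have hk : ∀ j x, Continuous fun y => g y * N j (r * expT (x - y)) := fun j x =>
    hg.mul (continuous_comp_mul_expT (hN j) hr (continuous_const.sub continuous_id))
  have hle : ∀ j x y, ‖g y * N j (r * expT (x - y))‖ ≤ ‖g y‖ * u j := fun j x y => by
    rw [norm_mul]
    exact mul_le_mul_of_nonneg_left (hNu j _) (norm_nonneg _)
  have hgi : Integrable (fun y => ‖g y‖) haarT := integrable_haarT hg.norm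
  have hinner : ∀ x, HasSum (fun j => ∫ y, g y * N j (r * expT (x - y)) ∂haarT)
      (∫ y, g y * M (r * expT (x - y)) ∂haarT) := fun x => by
    refine hasSum_integral_of_dominated_convergence (fun j y => ‖g y‖ * u j)
      (fun j => (hk j x).aestronglyMeasurable) (fun j => .of_forall (hle j x))
      (.of_forall fun y => hu.mul_left _) ?_ (.of_forall fun y => (hM _).mul_left _)
    simp_rw [tsum_mul_left]
    exact hgi.mul_const _
  refine hasSum_integral_of_dominated_convergence
    (fun j x => (∫ y, ‖g y‖ ∂haarT) * u j * ‖h x‖)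
    (fun j => ((continuous_conv (hN j) hr hg).mul hh).aestronglyMeasurable)
    (fun j => .of_forall fun x => ?_) (.of_forall fun x => (hu.mul_left _).mul_right _) ?_
    (.of_forall fun x => (hinner x).mul_right _)
  · rw [norm_mul, ← integral_mul_const]
    refine mul_le_mul_of_nonneg_right ?_ (norm_nonneg _)
    exact norm_integral_le_of_norm_le (hgi.mul_const _) (.of_forall (hle j x))
  · simp_rw [tsum_mul_right]
    exact (integrable_haarT hh.norm).const_mul _

/-- The power series with coefficients `a`. -/
def powerSum (a : ℕ → ℝ) (w : ℂ) : ℂ := ∑' j, (a j : ℂ) * w ^ j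

lemma summable_powerSum {a : ℕ → ℝ} (ha : ∀ j, 0 ≤ a j)
    (hs : ∀ t ∈ Ico (0 : ℝ) 1, Summable fun j => a j * t ^ j) {w : ℂ}
    (hw : w ∈ Metric.ball (0 : ℂ) 1) : Summable fun j => (a j : ℂ) * w ^ j := by
  refine .of_norm ?_
  convert hs ‖w‖ ⟨norm_nonneg w, mem_ball_zero_iff.1 hw⟩ using 2 with j
  rw [norm_mul, norm_pow, Complex.norm_real, Real.norm_of_nonneg (ha j)]

lemma differentiableOn_powerSum {a : ℕ → ℝ} (ha : ∀ j, 0 ≤ a j)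
    (hs : ∀ t ∈ Ico (0 : ℝ) 1, Summable fun j => a j * t ^ j) :
    DifferentiableOn ℂ (powerSum a) (Metric.ball 0 1) := by
  intro w hw
  obtain ⟨R, hwR, hR⟩ := exists_between (mem_ball_zero_iff.1 hw)
  have hR0 : 0 ≤ R := (norm_nonneg w).trans hwR.le
  have := Complex.differentiableOn_tsum_of_summable_norm (F := fun j (w : ℂ) => (a j : ℂ) * w ^ j)
    (hs R ⟨hR0, hR⟩) (fun j => by fun_prop) (Metric.isOpen_ball (x := (0 : ℂ)) (ε := R))
    (fun j z hz => by
      rw [norm_mul, norm_pow, Complex.norm_real, Real.norm_of_nonneg (ha j)]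
      have := (mem_ball_zero_iff.1 hz).le
      have := ha j
      gcongr)
  exact (this.differentiableAt (Metric.isOpen_ball.mem_nhds
    (by simpa using hwR))).differentiableWithinAt

/-- Convolution with a power series with nonnegative increasing coefficients. -/
lemma exists_norm_convForm_powerSum_le {p q : ℝ} (hpq : p.HolderConjugate q) :
    ∃ A > 0, ∀ a : ℕ → ℝ, (∀ j, 0 ≤ a j) → Monotone a →
      (∀ t ∈ Ico (0 : ℝ) 1, Summable fun j => a j * t ^ j) →
      ∀ t ∈ Ico (0 : ℝ) 1, ∀ g h : Torus → ℂ, Continuous g → Continuous h →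
      ‖convForm (powerSum a) t g h‖
        ≤ A * ((1 - t) * ∑' j, a j * t ^ j) * (torusNorm p g * torusNorm q h) := by
  obtain ⟨A, hA, hQ⟩ := exists_norm_convForm_le hpq
  refine ⟨A, hA, fun a ha hmono hs t ht g h hg hh => ?_⟩
  set b : ℕ → ℝ := fun j => a j - if j = 0 then 0 else a (j - 1) with hb
  have hb0 : ∀ j, 0 ≤ b j := fun j => by
    rcases j with _ | j
    · simpa [hb] using ha 0
    · simpa [hb] using hmono (Nat.le_succ j)
  have hba : ∀ j, b j ≤ a j := fun j => by
    rcases j with _ | j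
    · simp [hb]
    · simpa [hb] using ha j
  -- summation by parts
  have habel : ∀ {w : ℂ}, w ∈ Metric.ball (0 : ℂ) 1 →
      HasSum (fun j => (b j : ℂ) * w ^ j) ((1 - w) * powerSum a w) := by
    intro w hw
    have h1 := (summable_powerSum ha hs hw).hasSum
    have h2 : HasSum (fun j : ℕ => ((if j = 0 then 0 else a (j - 1) : ℝ) : ℂ) * w ^ j)
        (w * powerSum a w) := by
      rw [← hasSum_nat_add_iff' 1]
      simp only [Finset.range_one, Finset.sum_singleton, if_true, Complex.ofReal_zero, zero_mul,
        sub_zero, Nat.add_eq_zero_iff, one_ne_zero, and_false, if_false, Nat.add_sub_cancel]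
      refine (h1.mul_left w).congr_fun ?_
      intro j; ring
    have h3 := h1.sub h2
    rw [one_sub_mul]
    refine h3.congr_fun fun j => ?_
    simp only [hb]
    push_cast
    ring
  have htb : ((t : ℝ) : ℂ) ∈ Metric.ball (0 : ℂ) 1 := by simpa [abs_of_nonneg ht.1] using ht.2
  have hbt : HasSum (fun j => b j * t ^ j) ((1 - t) * ∑' j, a j * t ^ j) := by
    have := habel htb
    rw [powerSum] at this
    rw [← Complex.hasSum_ofReal]
    push_cast
    exact this
  set Q : ℂ → ℂ := fun w => (1 - w)⁻¹ with hQd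
  have hQc : ContinuousOn Q (Metric.ball 0 1) := differentiableOn_one_sub_inv.continuousOn
  obtain ⟨K, hK⟩ : ∃ K, ∀ x, ‖Q (t * expT x)‖ ≤ K := by
    obtain ⟨K, hK⟩ := isCompact_univ.exists_bound_of_continuousOn
      (continuous_comp_mul_expT hQc ht continuous_id).continuousOn
    exact ⟨K, fun x => hK x (mem_univ x)⟩
  have hsum := hasSum_convForm (N := fun j w => (b j : ℂ) * w ^ j * Q w) (M := powerSum a) ht
    (fun j => ContinuousOn.mul (by fun_prop) hQc)
    (fun x => by
      have hm := ofReal_mul_expT_mem_ball ht x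
      have := (habel hm).mul_right (Q (t * expT x))
      rwa [mul_right_comm, hQd, mul_inv_cancel₀ (one_sub_ne_zero_of_mem_ball hm), one_mul] at this)
    (u := fun j => b j * t ^ j * K) (hbt.summable.mul_right K)
    (fun j x => by
      rw [norm_mul, norm_mul, norm_pow, Complex.norm_real, Real.norm_of_nonneg (hb0 j), norm_mul,
        norm_expT, Complex.norm_real, Real.norm_of_nonneg ht.1, mul_one]
      exact mul_le_mul_of_nonneg_left (hK x) (mul_nonneg (hb0 j) (pow_nonneg ht.1 j)))
    hg hh
  have hterm : ∀ j, convForm (fun w => (b j : ℂ) * w ^ j * Q w) t g h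
      = ((b j * t ^ j : ℝ) : ℂ) *
        convForm Q t (fun y => g y * expT (-y) ^ j) (fun x => h x * expT x ^ j) := by
    intro j
    unfold convForm
    rw [← integral_const_mul]
    congr 1; ext x
    simp_rw [← integral_mul_const, ← integral_const_mul]
    congr 1; ext y
    rw [mul_pow, sub_eq_add_neg x y, expT_add, mul_pow]
    push_cast
    ring
  have hnorm : ∀ s (u : Torus → ℂ) (c : Torus → ℂ), (∀ x, ‖c x‖ = 1) →
      torusNorm s (fun x => u x * c x) = torusNorm s u := fun s u c hc => by
    simp [torusNorm, hc]
  rw [← hsum.tsum_eq]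
  have hfin := (hbt.mul_left A).mul_right (torusNorm p g * torusNorm q h)
  refine tsum_of_norm_bounded hfin fun j => ?_
  simp only [hterm]
  rw [norm_mul, Complex.norm_real, Real.norm_of_nonneg (mul_nonneg (hb0 j) (pow_nonneg ht.1 j)),
    mul_comm A, mul_assoc (b j * t ^ j)]
  refine mul_le_mul_of_nonneg_left ?_ (mul_nonneg (hb0 j) (pow_nonneg ht.1 j))
  have hc : Continuous fun x => expT x ^ j := continuous_expT.pow j
  have h1 := hQ t ht (fun y => g y * expT (-y) ^ j) (fun x => h x * expT x ^ j)
    (hg.mul (hc.comp continuous_neg)) (hh.mul hc)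
  rwa [hnorm p g _ (by simp), hnorm q h _ (by simp)] at h1

lemma IsRadialWeight.intervalIntegrable {ω : ℝ → ℝ} (hω : IsRadialWeight ω) {a b : ℝ}
    (ha : 0 ≤ a) (hab : a ≤ b) (hb : b ≤ 1) : IntervalIntegrable ω volume a b := by
  rw [intervalIntegrable_iff_integrableOn_Ico_of_le hab]
  exact hω.2.mono_set (Ico_subset_Ico ha hb)

lemma IsRadialWeight.intervalIntegrable_rpow_mul {ω : ℝ → ℝ} (hω : IsRadialWeight ω) {x : ℝ}
    (hx : 0 ≤ x) {a b : ℝ} (ha : 0 ≤ a) (hab : a ≤ b) (hb : b ≤ 1) :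
    IntervalIntegrable (fun r => r ^ x * ω r) volume a b :=
  (hω.intervalIntegrable ha hab hb).continuousOn_mul
    (continuous_id.rpow_const fun _ => Or.inr hx).continuousOn

lemma IsRadialWeight.rpow_mul_omegaHat_le_momentW {ω : ℝ → ℝ} (hω : IsRadialWeight ω) {x : ℝ}
    (hx : 0 ≤ x) {s : ℝ} (hs : s ∈ Ico (0 : ℝ) 1) : s ^ x * omegaHat ω s ≤ momentW ω x := by
  have h0 := hω.intervalIntegrable_rpow_mul hx le_rfl hs.1 hs.2.le
  have h1 := hω.intervalIntegrable_rpow_mul hx hs.1 hs.2.le le_rfl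
  rw [momentW, ← intervalIntegral.integral_add_adjacent_intervals h0 h1, omegaHat,
    ← intervalIntegral.integral_const_mul]
  have h2 : 0 ≤ ∫ r in (0 : ℝ)..s, r ^ x * ω r :=
    intervalIntegral.integral_nonneg_of_ae_restrict hs.1 (by
      rw [Filter.EventuallyLE, ae_restrict_iff' measurableSet_Icc]
      exact .of_forall fun r hr => mul_nonneg (Real.rpow_nonneg hr.1 x)
        (hω.1 r ⟨hr.1, hr.2.trans_lt hs.2⟩))
  have h3 : ∫ r in s..1, s ^ x * ω r ≤ ∫ r in s..1, r ^ x * ω r := by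
    refine intervalIntegral.integral_mono_on_of_le_Ioo hs.2.le
      ((hω.intervalIntegrable hs.1 hs.2.le le_rfl).const_mul _) h1 fun r hr => ?_
    exact mul_le_mul_of_nonneg_right (Real.rpow_le_rpow hs.1 hr.1.le hx)
      (hω.1 r ⟨hs.1.trans hr.1.le, hr.2⟩)
  linarith

lemma IsRadialWeight.momentW_anti {ω : ℝ → ℝ} (hω : IsRadialWeight ω) {x y : ℝ}
    (hx : 0 ≤ x) (hxy : x ≤ y) : momentW ω y ≤ momentW ω x := by
  refine intervalIntegral.integral_mono_on_of_le_Ioo zero_le_one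
    (hω.intervalIntegrable_rpow_mul (hx.trans hxy) le_rfl zero_le_one le_rfl)
    (hω.intervalIntegrable_rpow_mul hx le_rfl zero_le_one le_rfl) fun r hr => ?_
  exact mul_le_mul_of_nonneg_right (Real.rpow_le_rpow_of_exponent_ge hr.1 hr.2.le hxy)
    (hω.1 r ⟨hr.1.le, hr.2⟩)

/-- The Taylor coefficients of the Bergman kernel. -/
def kernelCoeff (ω : ℝ → ℝ) (j : ℕ) : ℝ := (2 * momentW ω (2 * (j : ℝ) + 1))⁻¹

lemma momentW_pos {ω : ℝ → ℝ} (hω : IsRadialWeight ω)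
    (hpos : ∀ r ∈ Ico (0 : ℝ) 1, 0 < omegaHat ω r) {x : ℝ} (hx : 0 ≤ x) : 0 < momentW ω x := by
  have hs : (1 / 2 : ℝ) ∈ Ico (0 : ℝ) 1 := by constructor <;> norm_num
  refine lt_of_lt_of_le ?_ (hω.rpow_mul_omegaHat_le_momentW hx hs)
  have := hpos _ hs
  positivity

lemma kernelCoeff_nonneg {ω : ℝ → ℝ} (hω : IsRadialWeight ω)
    (hpos : ∀ r ∈ Ico (0 : ℝ) 1, 0 < omegaHat ω r) (j : ℕ) : 0 ≤ kernelCoeff ω j := by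
  have := momentW_pos hω hpos (x := 2 * (j : ℝ) + 1) (by positivity)
  unfold kernelCoeff
  positivity

lemma monotone_kernelCoeff {ω : ℝ → ℝ} (hω : IsRadialWeight ω)
    (hpos : ∀ r ∈ Ico (0 : ℝ) 1, 0 < omegaHat ω r) : Monotone (kernelCoeff ω) := by
  intro i j hij
  have hj := momentW_pos hω hpos (x := 2 * (j : ℝ) + 1) (by positivity)
  have hij' : (i : ℝ) ≤ j := by exact_mod_cast hij
  have := hω.momentW_anti (x := 2 * (i : ℝ) + 1) (y := 2 * (j : ℝ) + 1) (by positivity)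
    (by linarith)
  unfold kernelCoeff
  gcongr

lemma omegaHat_le_pow_mul {ω : ℝ → ℝ} {γ : ℕ}
    (hγ : ∀ r ∈ Ico (0 : ℝ) 1, omegaHat ω r ≤ 2 ^ γ * omegaHat ω ((1 + r) / 2))
    {t : ℝ} (ht : t ∈ Ico (0 : ℝ) 1) (k : ℕ) :
    omegaHat ω t ≤ (2 ^ k) ^ γ * omegaHat ω (1 - (1 - t) / 2 ^ k) := by
  induction k with
  | zero => simp
  | succ k ih =>
    have h2 : (1 : ℝ) ≤ 2 ^ k := one_le_pow₀ (by norm_num)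
    have h3 : (1 - t) / 2 ^ k ≤ 1 - t := div_le_self (by linarith [ht.2]) h2
    have h4 : 0 < (1 - t) / 2 ^ k := div_pos (by linarith [ht.2]) (by positivity)
    have h5 := hγ (1 - (1 - t) / 2 ^ k) ⟨by linarith [ht.1], by linarith⟩
    rw [show (1 + (1 - (1 - t) / 2 ^ k)) / 2 = 1 - (1 - t) / 2 ^ (k + 1) by
      rw [pow_succ]; field_simp; ring] at h5
    calc _ ≤ _ := ih
      _ ≤ (2 ^ k) ^ γ * (2 ^ γ * omegaHat ω (1 - (1 - t) / 2 ^ (k + 1))) := by gcongr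
      _ = _ := by rw [pow_succ (2 : ℝ) k, mul_pow]; ring

lemma kernelCoeff_le {ω : ℝ → ℝ} (hω : IsRadialWeight ω)
    (hpos : ∀ r ∈ Ico (0 : ℝ) 1, 0 < omegaHat ω r) {γ : ℕ}
    (hγ : ∀ r ∈ Ico (0 : ℝ) 1, omegaHat ω r ≤ 2 ^ γ * omegaHat ω ((1 + r) / 2))
    {t : ℝ} (ht : t ∈ Ico (0 : ℝ) 1) (j : ℕ) :
    kernelCoeff ω j ≤ (8 * (1 + j * (1 - t))) ^ γ / omegaHat ω t := by
  have ht1 : 0 < 1 - t := by linarith [ht.2]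
  set x : ℝ := 2 * (j : ℝ) + 1 with hx
  have hx1 : 1 ≤ x := by rw [hx]; linarith [Nat.cast_nonneg (α := ℝ) j]
  set y : ℝ := 1 + 2 * ((1 - t) * x) with hy
  have hy1 : 1 ≤ y := by rw [hy]; nlinarith
  obtain ⟨n, hn1, hn2⟩ := exists_nat_pow_near hy1 (by norm_num : (1 : ℝ) < 2)
  set s : ℝ := 1 - (1 - t) / 2 ^ (n + 1) with hs
  have hp : (0 : ℝ) < 2 ^ (n + 1) := by positivity
  have hu0 : 0 < (1 - t) / 2 ^ (n + 1) := by positivity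
  have hux : x * ((1 - t) / 2 ^ (n + 1)) ≤ 1 / 2 := by
    rw [← mul_div_assoc, div_le_iff₀ hp]
    linarith
  have hsm : s ∈ Ico (0 : ℝ) 1 := ⟨by rw [hs]; nlinarith, by rw [hs]; linarith⟩
  have hbern : 1 / 2 ≤ s ^ x := by
    have := one_add_mul_self_le_rpow_one_add (s := -((1 - t) / 2 ^ (n + 1))) (by nlinarith) hx1
    rw [← sub_eq_add_neg, ← hs] at this
    linarith
  have hm := hω.rpow_mul_omegaHat_le_momentW (x := x) (by linarith) hsm
  have hd := omegaHat_le_pow_mul hγ ht (n + 1)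
  have hwt := hpos t ht
  have hws := hpos s hsm
  have hle : (2 : ℝ) ^ (n + 1) ≤ 8 * (1 + j * (1 - t)) := by
    rw [pow_succ]
    have : (2 : ℝ) ^ n * 2 ≤ y * 2 := by linarith
    refine this.trans ?_
    rw [hy, hx]
    nlinarith [ht.1]
  have hfin : omegaHat ω t ≤ (8 * (1 + j * (1 - t))) ^ γ * (2 * momentW ω x) := by
    calc _ ≤ _ := hd
      _ ≤ (8 * (1 + j * (1 - t))) ^ γ * omegaHat ω s := by gcongr
      _ ≤ _ := by
        have : omegaHat ω s ≤ 2 * momentW ω x := by nlinarith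
        have h8 : 0 ≤ 8 * (1 + j * (1 - t)) := hp.le.trans hle
        gcongr
  have hmp := momentW_pos hω hpos (x := x) (by linarith)
  rw [kernelCoeff, ← hx, le_div_iff₀ hwt, inv_mul_le_iff₀ (by positivity)]
  linarith

/-- The moment estimate behind the boundedness of the Bergman projection. -/
lemma exists_tsum_kernelCoeff_le {ω : ℝ → ℝ} (hω : IsRadialWeight ω)
    (hpos : ∀ r ∈ Ico (0 : ℝ) 1, 0 < omegaHat ω r) (hD : InDhat ω) :
    ∃ C > 0, ∀ t ∈ Ico (0 : ℝ) 1, Summable (fun j => kernelCoeff ω j * t ^ j) ∧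
      (1 - t) * ∑' j, kernelCoeff ω j * t ^ j ≤ C / omegaHat ω t := by
  obtain ⟨C, hC, hCD⟩ := hD
  obtain ⟨γ, hCγ⟩ := pow_unbounded_of_one_lt C (by norm_num : (1 : ℝ) < 2)
  have hγ : ∀ r ∈ Ico (0 : ℝ) 1, omegaHat ω r ≤ 2 ^ γ * omegaHat ω ((1 + r) / 2) := by
    intro r hr
    refine (hCD r hr).trans (mul_le_mul_of_nonneg_right hCγ.le (hpos _ ⟨?_, ?_⟩).le)
    · linarith [hr.1]
    · linarith [hr.2]
  set K : ℝ := 16 ^ γ * γ.factorial * Real.exp (1 / 2) with hK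
  refine ⟨4 * K, by positivity, fun t ht => ?_⟩
  have hv : 0 < 1 - t := by linarith [ht.2]
  have hwt := hpos t ht
  set ρ : ℝ := Real.exp (-((1 - t) / 2)) with hρ
  have hρ0 : 0 ≤ ρ := (Real.exp_pos _).le
  have hρ1 : ρ < 1 := by rw [hρ, Real.exp_lt_one_iff]; linarith
  have hterm : ∀ j : ℕ, kernelCoeff ω j * t ^ j ≤ K / omegaHat ω t * ρ ^ j := by
    intro j
    have h1 := kernelCoeff_le hω hpos hγ ht j
    have h2 : (8 * (1 + j * (1 - t))) ^ γ
        ≤ 16 ^ γ * γ.factorial * Real.exp ((1 + j * (1 - t)) / 2) := by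
      have := Real.pow_div_factorial_le_exp ((1 + j * (1 - t)) / 2) (by positivity) γ
      rw [div_le_iff₀ (by positivity)] at this
      calc (8 * (1 + j * (1 - t))) ^ γ = 16 ^ γ * ((1 + j * (1 - t)) / 2) ^ γ := by
            rw [← mul_pow]; ring
        _ ≤ 16 ^ γ * (Real.exp ((1 + j * (1 - t)) / 2) * γ.factorial) := by gcongr
        _ = _ := by ring
    have h3 : t ^ j ≤ Real.exp (-(1 - t)) ^ j := by
      have := Real.add_one_le_exp (-(1 - t))
      exact pow_le_pow_left₀ ht.1 (by linarith) j
    have h4 : Real.exp ((1 + j * (1 - t)) / 2) * Real.exp (-(1 - t)) ^ j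
        = Real.exp (1 / 2) * ρ ^ j := by
      rw [hρ, ← Real.exp_nat_mul, ← Real.exp_nat_mul, ← Real.exp_add, ← Real.exp_add]
      congr 1; ring
    calc kernelCoeff ω j * t ^ j
        ≤ (16 ^ γ * γ.factorial * Real.exp ((1 + j * (1 - t)) / 2)) / omegaHat ω t
          * Real.exp (-(1 - t)) ^ j := by
          refine mul_le_mul (h1.trans (by gcongr)) h3 (pow_nonneg ht.1 j) (by positivity)
      _ = 16 ^ γ * γ.factorial * (Real.exp ((1 + j * (1 - t)) / 2) * Real.exp (-(1 - t)) ^ j)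
          / omegaHat ω t := by ring
      _ = _ := by rw [h4, hK]; ring
  have hgeo : HasSum (fun j => K / omegaHat ω t * ρ ^ j) (K / omegaHat ω t * (1 - ρ)⁻¹) :=
    (hasSum_geometric_of_lt_one hρ0 hρ1).mul_left _
  have hnn : ∀ j, 0 ≤ kernelCoeff ω j * t ^ j := fun j =>
    mul_nonneg (kernelCoeff_nonneg hω hpos j) (pow_nonneg ht.1 j)
  have hsum : Summable fun j => kernelCoeff ω j * t ^ j :=
    Summable.of_nonneg_of_le hnn hterm hgeo.summable
  refine ⟨hsum, ?_⟩
  have hle : ∑' j, kernelCoeff ω j * t ^ j ≤ K / omegaHat ω t * (1 - ρ)⁻¹ :=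
    (hsum.tsum_le_tsum hterm hgeo.summable).trans_eq hgeo.tsum_eq
  have h5 : (1 - t) / 4 ≤ 1 - ρ := by
    have h6 : (1 - t) / 2 + 1 ≤ Real.exp ((1 - t) / 2) := Real.add_one_le_exp _
    have h7 : Real.exp ((1 - t) / 2) * ρ = 1 := by rw [hρ, ← Real.exp_add]; simp
    have h8 : ((1 - t) / 2 + 1) * ρ ≤ 1 := by nlinarith
    nlinarith [ht.1]
  have h9 : (1 - t) * (1 - ρ)⁻¹ ≤ 4 := by
    rw [← div_eq_mul_inv, div_le_iff₀ (by linarith)]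
    linarith
  calc _ ≤ (1 - t) * (K / omegaHat ω t * (1 - ρ)⁻¹) := by gcongr
    _ = K / omegaHat ω t * ((1 - t) * (1 - ρ)⁻¹) := by ring
    _ ≤ K / omegaHat ω t * 4 := by gcongr
    _ = _ := by ring

lemma lintegral_Ioc_rpow {a c : ℝ} (ha : -1 < a) (hc : 0 ≤ c) :
    ∫⁻ t in Ioc 0 c, ENNReal.ofReal (t ^ a) = ENNReal.ofReal (c ^ (a + 1) / (a + 1)) := by
  have h : IntegrableOn (fun t : ℝ => t ^ a) (Ioc 0 c) := by
    rw [← intervalIntegrable_iff_integrableOn_Ioc_of_le hc]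
    exact intervalIntegral.intervalIntegrable_rpow' ha
  rw [← ofReal_integral_eq_lintegral_ofReal h
    ((ae_restrict_iff' measurableSet_Ioc).2 (.of_forall fun t ht => Real.rpow_nonneg ht.1.le a)),
    ← intervalIntegral.integral_of_le hc, integral_rpow (Or.inl ha),
    Real.zero_rpow (by linarith), sub_zero]

lemma lintegral_Ioi_rpow {a c : ℝ} (ha : a < -1) (hc : 0 < c) :
    ∫⁻ t in Ioi c, ENNReal.ofReal (t ^ a) = ENNReal.ofReal (-c ^ (a + 1) / (a + 1)) := by
  rw [← ofReal_integral_eq_lintegral_ofReal (integrableOn_Ioi_rpow_of_lt ha hc)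
    ((ae_restrict_iff' measurableSet_Ioi).2
      (.of_forall fun t ht => Real.rpow_nonneg (hc.trans ht).le a)),
    integral_Ioi_rpow_of_lt ha hc]

section

variable {Ω : Type*} [MeasurableSpace Ω] {ν : Measure Ω} {v : Ω → ℝ}

lemma lintegral_rpow_neg_le_of_le (hv : Measurable v) (hv0 : ∀ s, 0 < v s)
    (hle : ∀ x > 0, ν {s | v s ≤ x} ≤ ENNReal.ofReal x) {α X : ℝ} (hα : 0 < α) (hα1 : α < 1)
    (hX : 0 < X) :
    ∫⁻ s in {s | v s ≤ X}, ENNReal.ofReal (v s ^ (-α)) ∂ν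
      ≤ ENNReal.ofReal (X ^ (1 - α) / (1 - α)) := by
  have h1 := lintegral_rpow_eq_lintegral_meas_lt_mul (ν.restrict {s | v s ≤ X})
    (f := fun s => (v s)⁻¹) (.of_forall fun s => (inv_pos.2 (hv0 s)).le) hv.inv.aemeasurable hα
  simp_rw [Real.inv_rpow (hv0 _).le, ← Real.rpow_neg (hv0 _).le] at h1
  have hX' : 0 < X⁻¹ := inv_pos.2 hX
  have hIoc : ∫⁻ t in Ioc 0 X⁻¹, (ν.restrict {s | v s ≤ X}) {s | t < (v s)⁻¹}
      * ENNReal.ofReal (t ^ (α - 1)) ≤ ENNReal.ofReal (X ^ (1 - α) / α) := by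
    calc _ ≤ ∫⁻ t in Ioc 0 X⁻¹, ENNReal.ofReal X * ENNReal.ofReal (t ^ (α - 1)) := by
          refine lintegral_mono fun t => mul_le_mul_left ?_ _
          refine (measure_mono (subset_univ _)).trans ?_
          rw [Measure.restrict_apply_univ]
          exact hle X hX
      _ = ENNReal.ofReal (X ^ (1 - α) / α) := by
          rw [lintegral_const_mul' _ _ ENNReal.ofReal_ne_top, lintegral_Ioc_rpow
            (by linarith) hX'.le,
            ← ENNReal.ofReal_mul hX.le, sub_add_cancel, Real.inv_rpow hX.le, Real.rpow_sub hX,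
            Real.rpow_one]
          congr 1; ring
  have hIoi : ∫⁻ t in Ioi X⁻¹, (ν.restrict {s | v s ≤ X}) {s | t < (v s)⁻¹}
      * ENNReal.ofReal (t ^ (α - 1)) ≤ ENNReal.ofReal (X ^ (1 - α) / (1 - α)) := by
    calc _ ≤ ∫⁻ t in Ioi X⁻¹, ENNReal.ofReal (t ^ (α - 2)) := by
          refine setLIntegral_mono' measurableSet_Ioi fun t ht => ?_
          have ht0 : 0 < t := hX'.trans ht
          rw [show α - 2 = -1 + (α - 1) by ring, Real.rpow_add ht0, Real.rpow_neg_one,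
            ENNReal.ofReal_mul (inv_pos.2 ht0).le]
          refine mul_le_mul_left ?_ _
          refine (Measure.restrict_apply_le _ _).trans ((measure_mono ?_).trans
            (hle t⁻¹ (inv_pos.2 ht0)))
          intro s hs
          exact ((lt_inv_comm₀ ht0 (hv0 s)).1 hs).le
      _ = ENNReal.ofReal (X ^ (1 - α) / (1 - α)) := by
          rw [lintegral_Ioi_rpow (by linarith) hX', Real.inv_rpow hX.le, ← Real.rpow_neg hX.le,
            show -(α - 2 + 1) = 1 - α by ring, show α - 2 + 1 = -(1 - α) by ring, neg_div_neg_eq]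
  have h1α : 0 < 1 - α := by linarith
  rw [h1, ← Ioc_union_Ioi_eq_Ioi hX'.le, lintegral_union measurableSet_Ioi
    (Set.disjoint_left.2 fun t ht ht' => not_lt.2 ht.2 ht')]
  calc _ ≤ ENNReal.ofReal α * (ENNReal.ofReal (X ^ (1 - α) / α)
        + ENNReal.ofReal (X ^ (1 - α) / (1 - α))) := by gcongr
    _ = _ := by
        rw [← ENNReal.ofReal_add (by positivity) (by positivity), ← ENNReal.ofReal_mul hα.le]
        congr 1
        field_simp
        ring

lemma lintegral_rpow_neg_le_of_lt (hv : Measurable v) (hv0 : ∀ s, 0 < v s)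
    (hle : ∀ x > 0, ν {s | v s ≤ x} ≤ ENNReal.ofReal x) {α X : ℝ} (hα : 0 < α)
    (hX : 0 < X) :
    ∫⁻ s in {s | v s ≤ X}ᶜ, ENNReal.ofReal (v s ^ (-(1 + α))) ∂ν
      ≤ ENNReal.ofReal ((1 + α) / α * X ^ (-α)) := by
  have hα1 : 0 < 1 + α := by linarith
  have h1 := lintegral_rpow_eq_lintegral_meas_lt_mul (ν.restrict {s | v s ≤ X}ᶜ)
    (f := fun s => (v s)⁻¹) (.of_forall fun s => (inv_pos.2 (hv0 s)).le) hv.inv.aemeasurable hα1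
  simp_rw [Real.inv_rpow (hv0 _).le, ← Real.rpow_neg (hv0 _).le] at h1
  have hX' : 0 < X⁻¹ := inv_pos.2 hX
  have hIoc : ∫⁻ t in Ioc 0 X⁻¹, (ν.restrict {s | v s ≤ X}ᶜ) {s | t < (v s)⁻¹}
      * ENNReal.ofReal (t ^ (1 + α - 1)) ≤ ENNReal.ofReal (X ^ (-α) / α) := by
    calc _ ≤ ∫⁻ t in Ioc 0 X⁻¹, ENNReal.ofReal (t ^ (α - 1)) := by
          refine setLIntegral_mono' measurableSet_Ioc fun t ht => ?_
          have ht0 : 0 < t := ht.1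
          rw [show α - 1 = -1 + (1 + α - 1) by ring, Real.rpow_add ht0, Real.rpow_neg_one,
            ENNReal.ofReal_mul (inv_pos.2 ht0).le]
          refine mul_le_mul_left ?_ _
          refine (Measure.restrict_apply_le _ _).trans ((measure_mono ?_).trans
            (hle t⁻¹ (inv_pos.2 ht0)))
          intro s hs
          exact ((lt_inv_comm₀ ht0 (hv0 s)).1 hs).le
      _ = ENNReal.ofReal (X ^ (-α) / α) := by
          rw [lintegral_Ioc_rpow (by linarith) hX'.le, sub_add_cancel, Real.inv_rpow hX.le,
            Real.rpow_neg hX.le]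
  have hIoi : ∫⁻ t in Ioi X⁻¹, (ν.restrict {s | v s ≤ X}ᶜ) {s | t < (v s)⁻¹}
      * ENNReal.ofReal (t ^ (1 + α - 1)) = 0 := by
    refine setLIntegral_eq_zero measurableSet_Ioi fun t ht => ?_
    have ht0 : 0 < t := hX'.trans ht
    have : (ν.restrict {s | v s ≤ X}ᶜ) {s | t < (v s)⁻¹} = 0 := by
      have hm : MeasurableSet {s | t < (v s)⁻¹} := measurableSet_lt measurable_const hv.inv
      rw [Measure.restrict_apply hm]
      convert measure_empty (μ := ν)
      refine Set.eq_empty_of_forall_notMem fun s hs => hs.2 ?_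
      have h2 : X⁻¹ < (v s)⁻¹ := lt_trans ht hs.1
      exact ((inv_lt_inv₀ hX (hv0 s)).1 h2).le
    simp [this]
  rw [h1, ← Ioc_union_Ioi_eq_Ioi hX'.le, lintegral_union measurableSet_Ioi
    (Set.disjoint_left.2 fun t ht ht' => not_lt.2 ht.2 ht'), hIoi, add_zero]
  calc _ ≤ ENNReal.ofReal (1 + α) * ENNReal.ofReal (X ^ (-α) / α) := by gcongr
    _ = _ := by
        rw [← ENNReal.ofReal_mul hα1.le]
        congr 1
        ring

end

/-- The Schur test condition for the kernel `1 / max (v ρ) (v s)`. -/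
lemma exists_lintegral_inv_max_mul_rpow_le {α : ℝ} (hα : 0 < α) (hα1 : α < 1) :
    ∃ C > 0, ∀ {Ω : Type*} [MeasurableSpace Ω] {ν : Measure Ω} {v : Ω → ℝ},
      Measurable v → (∀ s, 0 < v s) → (∀ x > 0, ν {s | v s ≤ x} ≤ ENNReal.ofReal x) →
      ∀ X > 0, ∫⁻ s, ENNReal.ofReal (max X (v s))⁻¹ * ENNReal.ofReal (v s ^ (-α)) ∂ν
        ≤ ENNReal.ofReal (C * X ^ (-α)) := by
  have h1α : 0 < 1 - α := by linarith
  refine ⟨1 / (1 - α) + (1 + α) / α, by positivity, fun {Ω _ ν v} hv hv0 hle X hX => ?_⟩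
  have hS : MeasurableSet {s | v s ≤ X} := measurableSet_le hv measurable_const
  rw [← lintegral_add_compl _ hS, add_mul, ENNReal.ofReal_add (by positivity) (by positivity)]
  refine add_le_add ?_ ?_
  · calc _ = ∫⁻ s in {s | v s ≤ X}, ENNReal.ofReal X⁻¹ * ENNReal.ofReal (v s ^ (-α)) ∂ν := by
          refine setLIntegral_congr_fun hS fun s hs => ?_
          rw [max_eq_left (show v s ≤ X from hs)]
      _ ≤ ENNReal.ofReal X⁻¹ * ENNReal.ofReal (X ^ (1 - α) / (1 - α)) := by
          rw [lintegral_const_mul' _ _ ENNReal.ofReal_ne_top]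
          gcongr
          exact lintegral_rpow_neg_le_of_le hv hv0 hle hα hα1 hX
      _ = _ := by
          rw [← ENNReal.ofReal_mul (inv_pos.2 hX).le, sub_eq_add_neg 1 α, Real.rpow_add hX,
            Real.rpow_one]
          congr 1
          field_simp
  · calc _ = ∫⁻ s in {s | v s ≤ X}ᶜ, ENNReal.ofReal (v s ^ (-(1 + α))) ∂ν := by
          refine setLIntegral_congr_fun hS.compl fun s hs => ?_
          rw [max_eq_right (not_le.1 (show ¬ v s ≤ X from hs)).le,
            ← ENNReal.ofReal_mul (inv_pos.2 (hv0 s)).le, neg_add, Real.rpow_add (hv0 s),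
            Real.rpow_neg_one]
      _ ≤ _ := lintegral_rpow_neg_le_of_lt hv hv0 hle hα hX

/-- The Schur test for the kernel `1 / max (v ρ) (v s)`. -/
lemma exists_lintegral_inv_max_mul_rpow_le_mul {q : ℝ} (hq : 1 < q) :
    ∃ C > 0, ∀ {Ω : Type} [MeasurableSpace Ω] {ν : Measure Ω} [SFinite ν] {v : Ω → ℝ},
      Measurable v → (∀ s, 0 < v s) → (∀ x > 0, ν {s | v s ≤ x} ≤ ENNReal.ofReal x) →
      ∀ N : Ω → ℝ≥0∞, AEMeasurable N ν →
        ∫⁻ ρ, (∫⁻ s, N s * ENNReal.ofReal (max (v ρ) (v s))⁻¹ ∂ν) ^ q ∂ν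
          ≤ ENNReal.ofReal C * ∫⁻ s, N s ^ q ∂ν := by
  have hpq : q.HolderConjugate q.conjExponent := .conjExponent hq
  set p := q.conjExponent with hp
  have hq0 := hpq.pos
  have hp0 := hpq.symm.pos
  obtain ⟨C₁, hC₁, H₁⟩ := exists_lintegral_inv_max_mul_rpow_le (α := 1 / q) (by positivity)
    ((div_lt_one hq0).2 hq)
  obtain ⟨C₂, hC₂, H₂⟩ := exists_lintegral_inv_max_mul_rpow_le (α := 1 / p) (by positivity)
    ((div_lt_one hp0).2 hpq.symm.lt)
  refine ⟨C₁ ^ (q / p) * C₂, by positivity, fun {Ω _ ν _ v} hv hv0 hle N hN => ?_⟩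
  set k : Ω → Ω → ℝ≥0∞ := fun ρ s => ENNReal.ofReal (max (v ρ) (v s))⁻¹ with hk
  have hkm : Measurable (Function.uncurry k) :=
    ((hv.comp measurable_fst).max (hv.comp measurable_snd)).inv.ennreal_ofReal
  have hkm' : ∀ ρ, Measurable (k ρ) := fun ρ => (measurable_const.max hv).inv.ennreal_ofReal
  set b : ℝ := 1 / (q * p) with hb
  have hsplit : ∀ ρ s, N s * k ρ s = (k ρ s ^ (1 / p) * ENNReal.ofReal (v s ^ (-b)))
      * (k ρ s ^ (1 / q) * ENNReal.ofReal (v s ^ b) * N s) := by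
    intro ρ s
    have h1 : k ρ s ^ (1 / p) * k ρ s ^ (1 / q) = k ρ s := by
      rw [← ENNReal.rpow_add_of_nonneg _ _ (by positivity) (by positivity), one_div, one_div,
        hpq.symm.inv_add_inv_eq_one, ENNReal.rpow_one]
    have h2 : ENNReal.ofReal (v s ^ (-b)) * ENNReal.ofReal (v s ^ b) = 1 := by
      rw [← ENNReal.ofReal_mul (Real.rpow_nonneg (hv0 s).le _), ← Real.rpow_add (hv0 s)]
      simp
    calc N s * k ρ s = N s * (k ρ s ^ (1 / p) * k ρ s ^ (1 / q))
          * (ENNReal.ofReal (v s ^ (-b)) * ENNReal.ofReal (v s ^ b)) := by rw [h1, h2, mul_one]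
      _ = _ := by ring
  have hbp : b * p = 1 / q := by rw [hb]; field_simp
  have hbq : b * q = 1 / p := by rw [hb]; field_simp
  have hvr : ∀ (a : ℝ) {c : ℝ}, 0 ≤ c → ∀ s, ENNReal.ofReal (v s ^ a) ^ c =
      ENNReal.ofReal (v s ^ (a * c)) := by
    intro a c hc s
    rw [ENNReal.ofReal_rpow_of_nonneg (Real.rpow_nonneg (hv0 s).le _) hc, ← Real.rpow_mul
      (hv0 s).le]
  have hpoint : ∀ ρ, (∫⁻ s, N s * k ρ s ∂ν) ^ q ≤ ENNReal.ofReal (C₁ ^ (q / p)) *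
      (ENNReal.ofReal (v ρ ^ (-(1 / p))) *
        ∫⁻ s, k ρ s * (ENNReal.ofReal (v s ^ (1 / p)) * N s ^ q) ∂ν) := by
    intro ρ
    have hH := ENNReal.lintegral_mul_le_Lp_mul_Lq ν hpq.symm
      (f := fun s => k ρ s ^ (1 / p) * ENNReal.ofReal (v s ^ (-b)))
      (g := fun s => k ρ s ^ (1 / q) * ENNReal.ofReal (v s ^ b) * N s)
      (((hkm' ρ).pow_const _).mul (hv.pow_const _).ennreal_ofReal).aemeasurable
      ((((hkm' ρ).pow_const _).mul (hv.pow_const _).ennreal_ofReal).aemeasurable.mul hN)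
    simp only [Pi.mul_apply, ← hsplit] at hH
    have e1 : ∀ s, (k ρ s ^ (1 / p) * ENNReal.ofReal (v s ^ (-b))) ^ p
        = k ρ s * ENNReal.ofReal (v s ^ (-(1 / q))) := by
      intro s
      rw [ENNReal.mul_rpow_of_nonneg _ _ hp0.le, ← ENNReal.rpow_mul, one_div_mul_cancel hp0.ne',
        ENNReal.rpow_one, hvr _ hp0.le, neg_mul, hbp]
    have e2 : ∀ s, (k ρ s ^ (1 / q) * ENNReal.ofReal (v s ^ b) * N s) ^ q
        = k ρ s * (ENNReal.ofReal (v s ^ (1 / p)) * N s ^ q) := by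
      intro s
      rw [ENNReal.mul_rpow_of_nonneg _ _ hq0.le, ENNReal.mul_rpow_of_nonneg _ _ hq0.le,
        ← ENNReal.rpow_mul, one_div_mul_cancel hq0.ne',
        ENNReal.rpow_one, hvr _ hq0.le, hbq, mul_assoc]
    simp only [e1, e2] at hH
    have h3 := H₁ hv hv0 hle (v ρ) (hv0 ρ)
    have hqp : 0 ≤ q / p := by positivity
    calc _ ≤ ((ENNReal.ofReal (C₁ * v ρ ^ (-(1 / q)))) ^ (1 / p) *
          (∫⁻ s, k ρ s * (ENNReal.ofReal (v s ^ (1 / p)) * N s ^ q) ∂ν) ^ (1 / q)) ^ q := by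
          gcongr
          exact hH.trans (by gcongr)
      _ = _ := by
          rw [ENNReal.mul_rpow_of_nonneg _ _ hq0.le, ← ENNReal.rpow_mul, ← ENNReal.rpow_mul,
            one_div_mul_cancel hq0.ne', ENNReal.rpow_one, one_div_mul_eq_div,
            ENNReal.ofReal_mul hC₁.le, ENNReal.mul_rpow_of_nonneg _ _ hqp, hvr _ hqp,
            ENNReal.ofReal_rpow_of_nonneg hC₁.le hqp, mul_assoc,
            show -(1 / q) * (q / p) = -(1 / p) by field_simp]
  calc _ ≤ ∫⁻ ρ, ENNReal.ofReal (C₁ ^ (q / p)) * (ENNReal.ofReal (v ρ ^ (-(1 / p))) *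
        ∫⁻ s, k ρ s * (ENNReal.ofReal (v s ^ (1 / p)) * N s ^ q) ∂ν) ∂ν := lintegral_mono hpoint
    _ = ENNReal.ofReal (C₁ ^ (q / p)) * ∫⁻ ρ, ∫⁻ s, ENNReal.ofReal (v ρ ^ (-(1 / p))) *
        (k ρ s * (ENNReal.ofReal (v s ^ (1 / p)) * N s ^ q)) ∂ν ∂ν := by
        rw [lintegral_const_mul' _ _ ENNReal.ofReal_ne_top]
        simp_rw [lintegral_const_mul' _ _ ENNReal.ofReal_ne_top]
    _ = ENNReal.ofReal (C₁ ^ (q / p)) * ∫⁻ s, ∫⁻ ρ, ENNReal.ofReal (v ρ ^ (-(1 / p))) *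
        (k ρ s * (ENNReal.ofReal (v s ^ (1 / p)) * N s ^ q)) ∂ν ∂ν := by
        rw [lintegral_lintegral_swap]
        refine ((hv.comp measurable_fst).pow_const _).ennreal_ofReal.aemeasurable.mul
          (hkm.aemeasurable.mul
            (((hv.comp measurable_snd).pow_const _).ennreal_ofReal.aemeasurable.mul
              (hN.comp_snd.pow_const q)))
    _ ≤ ENNReal.ofReal (C₁ ^ (q / p)) * ∫⁻ s, ENNReal.ofReal C₂ * N s ^ q ∂ν := by
        gcongr with s
        have h4 : ∀ ρ, ENNReal.ofReal (v ρ ^ (-(1 / p))) *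
            (k ρ s * (ENNReal.ofReal (v s ^ (1 / p)) * N s ^ q))
            = ENNReal.ofReal (max (v s) (v ρ))⁻¹ * ENNReal.ofReal (v ρ ^ (-(1 / p))) *
              (ENNReal.ofReal (v s ^ (1 / p)) * N s ^ q) := by
          intro ρ
          simp only [hk]
          rw [max_comm]
          ring
        simp_rw [h4]
        have hm : Measurable fun ρ => ENNReal.ofReal (max (v s) (v ρ))⁻¹
            * ENNReal.ofReal (v ρ ^ (-(1 / p))) :=
          (measurable_const.max hv).inv.ennreal_ofReal.mul (hv.pow_const _).ennreal_ofReal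
        rw [lintegral_mul_const _ hm]
        calc _ ≤ ENNReal.ofReal (C₂ * v s ^ (-(1 / p))) *
              (ENNReal.ofReal (v s ^ (1 / p)) * N s ^ q) := by
              gcongr
              exact H₂ hv hv0 hle (v s) (hv0 s)
          _ = _ := by
              rw [← mul_assoc, ← ENNReal.ofReal_mul (mul_nonneg hC₂.le (Real.rpow_nonneg
                (hv0 s).le _)),
                mul_assoc C₂, ← Real.rpow_add (hv0 s)]
              simp
    _ = _ := by
        rw [lintegral_const_mul' _ _ ENNReal.ofReal_ne_top, ENNReal.ofReal_mul (by positivity),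
          mul_assoc]

lemma lintegral_Ioo_coe_torus (t : ℝ) (F : Torus → ℝ≥0∞) :
    ∫⁻ θ in Ioo t (t + 2 * Real.pi), F θ = ENNReal.ofReal (2 * Real.pi) * ∫⁻ x, F x ∂haarT := by
  rw [Measure.restrict_congr_set Ioo_ae_eq_Ioc, AddCircle.lintegral_preimage (2 * Real.pi) t F,
    AddCircle.volume_eq_smul_haarAddCircle, lintegral_smul_measure, smul_eq_mul]

lemma measurable_expT : Measurable expT := continuous_expT.measurable

/-- The radial part of area measure on the unit disc. -/
def radialArea : Measure ℝ :=
  (volume.restrict (Ioo 0 1)).withDensity fun r => ENNReal.ofReal (2 * Real.pi * r)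

instance : SFinite radialArea := by
  unfold radialArea
  infer_instance

lemma polarT_measurable : Measurable fun z : ℝ × Torus => (z.1 : ℂ) * expT z.2 :=
  (Complex.measurable_ofReal.comp measurable_fst).mul (measurable_expT.comp measurable_snd)

/-- Polar coordinates in the unit disc. -/
lemma measurePreserving_polarT :
    MeasurePreserving (fun z : ℝ × Torus => (z.1 : ℂ) * expT z.2) (radialArea.prod haarT)
      (volume.restrict (Metric.ball 0 1)) := by
  refine ⟨polarT_measurable, Measure.ext_of_lintegral _ fun F hF => ?_⟩
  have hFm : Measurable fun z : ℝ × Torus => F ((z.1 : ℂ) * expT z.2) := hF.comp polarT_measurable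
  rw [lintegral_map hF polarT_measurable, lintegral_prod _ hFm.aemeasurable, radialArea,
    lintegral_withDensity_eq_lintegral_mul _ (by fun_prop) hFm.lintegral_prod_right',
    ← lintegral_indicator measurableSet_ball, ← Complex.lintegral_comp_polarCoord_symm,
    polarCoord_target, Measure.volume_eq_prod, ← Measure.prod_restrict, lintegral_prod]
  · rw [← lintegral_indicator measurableSet_Ioo, ← lintegral_indicator measurableSet_Ioi]
    congr 1; ext r
    by_cases hr : r ∈ Ioo (0 : ℝ) 1
    · rw [indicator_of_mem hr, indicator_of_mem (show r ∈ Ioi (0 : ℝ) from hr.1)]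
      have h1 : ∀ θ : ℝ, ((Complex.polarCoord.symm (r, θ) : ℂ)) = (r : ℂ) * expT (θ : Torus) := by
        intro θ
        rw [Complex.polarCoord_symm_apply, expT_coe, Complex.exp_mul_I, Complex.ofReal_cos,
          Complex.ofReal_sin]
      have h2 : ∀ x : Torus, (r : ℂ) * expT x ∈ Metric.ball (0 : ℂ) 1 := fun x =>
        ofReal_mul_expT_mem_ball ⟨hr.1.le, hr.2⟩ x
      simp only [h1, indicator_of_mem (h2 _), smul_eq_mul]
      rw [lintegral_const_mul' _ _ ENNReal.ofReal_ne_top]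
      have h3 := lintegral_Ioo_coe_torus (-Real.pi) (fun x => F (r * expT x))
      rw [show -Real.pi + 2 * Real.pi = Real.pi by ring] at h3
      rw [h3, Pi.mul_apply, ← mul_assoc, ← ENNReal.ofReal_mul hr.1.le, mul_comm r]
    · rw [indicator_of_notMem hr]
      by_cases hr0 : r ∈ Ioi (0 : ℝ)
      · rw [indicator_of_mem hr0]
        have hr1 : 1 ≤ r := not_lt.1 fun h => hr ⟨hr0, h⟩
        have h2 : ∀ θ : ℝ, (Complex.polarCoord.symm (r, θ) : ℂ) ∉ Metric.ball (0 : ℂ) 1 := by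
          intro θ
          rw [mem_ball_zero_iff, Complex.norm_polarCoord_symm, not_lt]
          exact hr1.trans (le_abs_self r)
        simp only [indicator_of_notMem (h2 _), smul_zero, lintegral_zero]
      · rw [indicator_of_notMem hr0]
  · refine Measurable.aemeasurable ?_
    simp only [Complex.polarCoord_symm_apply]
    refine (measurable_fst.ennreal_ofReal).smul ((hF.indicator measurableSet_ball).comp ?_)
    fun_prop

/-- The `L^p` mean of `f` over the circle of radius `r`. -/
def sliceNorm (p : ℝ) (f : ℂ → ℂ) (r : ℝ) : ℝ≥0∞ :=
  (∫⁻ x, ‖f (r * expT x)‖ₑ ^ p ∂haarT) ^ (1 / p)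

lemma MpE_eq_sliceNorm {p : ℝ} (hp : 0 < p) (r : ℝ) (f : ℂ → ℂ) : MpE p r f = sliceNorm p f r := by
  have h := lintegral_Ioo_coe_torus 0 (fun x => ‖f (r * expT x)‖ₑ ^ p)
  rw [zero_add] at h
  have h2 : ∀ θ : ℝ, ENNReal.ofReal (‖f (circlePt r θ)‖ ^ p) = ‖f (r * expT (θ : Torus))‖ₑ ^ p := by
    intro θ
    rw [← ENNReal.ofReal_rpow_of_nonneg (norm_nonneg _) hp.le, ofReal_norm, circlePt, expT_coe]
  simp only [MpE, sliceNorm, h2]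
  rw [h, ← mul_assoc, ← ENNReal.ofReal_mul (by positivity),
    one_div_mul_cancel Real.two_pi_pos.ne', ENNReal.ofReal_one, one_mul]

lemma sliceNorm_eq_torusNorm {p : ℝ} (hp : 0 < p) {f : ℂ → ℂ} {r : ℝ}
    (hf : Continuous fun x : Torus => f (r * expT x)) :
    sliceNorm p f r = ENNReal.ofReal (torusNorm p fun x => f (r * expT x)) := by
  unfold sliceNorm torusNorm
  rw [← ENNReal.ofReal_rpow_of_nonneg (by positivity) (by positivity),
    ofReal_integral_eq_lintegral_ofReal
      (integrable_haarT (hf.norm.rpow_const fun _ => Or.inr hp.le))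
        (.of_forall fun x => by positivity)]
  congr 2; ext x
  rw [← ENNReal.ofReal_rpow_of_nonneg (norm_nonneg _) hp.le, ofReal_norm]

/-- The measure `r ω(r) dr` on `(0,1)`. -/
def radialMeasure (ω : ℝ → ℝ) : Measure ℝ :=
  (volume.restrict (Ioo 0 1)).withDensity fun r => ENNReal.ofReal (r * ω r)

instance (ω : ℝ → ℝ) : SFinite (radialMeasure ω) := by
  unfold radialMeasure
  infer_instance

lemma IsRadialWeight.aemeasurable {ω : ℝ → ℝ} (hω : IsRadialWeight ω) :
    AEMeasurable ω (volume.restrict (Ioo 0 1)) :=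
  (hω.2.mono_set Ioo_subset_Ico_self).aestronglyMeasurable.aemeasurable

lemma IsRadialWeight.aemeasurable_mul {ω : ℝ → ℝ} (hω : IsRadialWeight ω) :
    AEMeasurable (fun r => ENNReal.ofReal (r * ω r)) (volume.restrict (Ioo 0 1)) :=
  (aemeasurable_id'.mul hω.aemeasurable).ennreal_ofReal

lemma volume_restrict_absolutelyContinuous_radialArea :
    volume.restrict (Ioo (0 : ℝ) 1) ≪ radialArea := by
  refine withDensity_absolutelyContinuous' (by fun_prop) ?_
  rw [ae_restrict_iff' measurableSet_Ioo]
  refine .of_forall fun r hr => ?_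
  have := hr.1
  simp only [ne_eq, ENNReal.ofReal_eq_zero, not_le]
  positivity

lemma radialArea_absolutelyContinuous : radialArea ≪ volume.restrict (Ioo (0 : ℝ) 1) :=
  withDensity_absolutelyContinuous _ _

lemma ae_radialArea_mem : ∀ᵐ r ∂radialArea, r ∈ Ioo (0 : ℝ) 1 :=
  radialArea_absolutelyContinuous.ae_le (ae_restrict_mem measurableSet_Ioo)

lemma lintegral_radialArea_mul_weight {ω : ℝ → ℝ} (hω : IsRadialWeight ω) {F : ℝ → ℝ≥0∞}
    (hF : AEMeasurable F (volume.restrict (Ioo 0 1))) :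
    ∫⁻ r, ENNReal.ofReal (ω r) * F r ∂radialArea
      = ENNReal.ofReal (2 * Real.pi) * ∫⁻ r, F r ∂radialMeasure ω := by
  have hF' : AEMeasurable (fun r => ENNReal.ofReal (ω r) * F r) (volume.restrict (Ioo 0 1)) :=
    hω.aemeasurable.ennreal_ofReal.mul hF
  rw [radialArea, radialMeasure, lintegral_withDensity_eq_lintegral_mul₀ (by fun_prop) hF',
    lintegral_withDensity_eq_lintegral_mul₀ hω.aemeasurable_mul hF,
      ← lintegral_const_mul' _ _ ENNReal.ofReal_ne_top]
  refine setLIntegral_congr_fun measurableSet_Ioo fun r hr => ?_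
  simp only [Pi.mul_apply]
  rw [← mul_assoc, ← mul_assoc, ← ENNReal.ofReal_mul (by have := hr.1; positivity),
    ← ENNReal.ofReal_mul (by positivity), mul_assoc]

lemma aestronglyMeasurable_comp_polarT {f : ℂ → ℂ}
    (hf : AEStronglyMeasurable f (volume.restrict (Metric.ball (0 : ℂ) 1))) :
    AEStronglyMeasurable (fun z : ℝ × Torus => f (z.1 * expT z.2)) (radialArea.prod haarT) :=
  hf.comp_measurePreserving measurePreserving_polarT

lemma aemeasurable_sliceNorm {p : ℝ} {f : ℂ → ℂ}
    (hf : AEStronglyMeasurable f (volume.restrict (Metric.ball (0 : ℂ) 1))) :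
    AEMeasurable (sliceNorm p f) (volume.restrict (Ioo 0 1)) := by
  refine AEMeasurable.mono_ac ?_ volume_restrict_absolutelyContinuous_radialArea
  exact (((aestronglyMeasurable_comp_polarT hf).enorm.pow_const p).lintegral_prod_right').pow_const _

lemma LpqNormE_eq {ω : ℝ → ℝ} (hω : IsRadialWeight ω) {p q : ℝ} (hp : 0 < p) {f : ℂ → ℂ}
    (hf : AEStronglyMeasurable f (volume.restrict (Metric.ball (0 : ℂ) 1))) :
    LpqNormE ω p q f = (∫⁻ r, sliceNorm p f r ^ q ∂radialMeasure ω) ^ (1 / q) := by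
  have hs : AEMeasurable (fun r => sliceNorm p f r ^ q) (volume.restrict (Ioo 0 1)) :=
    (aemeasurable_sliceNorm hf).pow_const q
  rw [radialMeasure, lintegral_withDensity_eq_lintegral_mul₀ hω.aemeasurable_mul hs]
  simp only [LpqNormE, MpE_eq_sliceNorm hp, Pi.mul_apply, mul_comm]

lemma aemeasurable_weight_comp_norm {ω : ℝ → ℝ} (hω : IsRadialWeight ω) :
    AEMeasurable (fun ζ : ℂ => ω ‖ζ‖) (volume.restrict (Metric.ball (0 : ℂ) 1)) := by
  refine hω.aemeasurable.comp_quasiMeasurePreserving ⟨measurable_norm, ?_⟩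
  rw [← measurePreserving_polarT.map_eq, Measure.map_map measurable_norm polarT_measurable]
  refine .trans ?_ radialArea_absolutelyContinuous
  have h : (norm ∘ fun z : ℝ × Torus => (z.1 : ℂ) * expT z.2)
      =ᵐ[radialArea.prod haarT] Prod.fst := by
    have := Measure.quasiMeasurePreserving_fst (μ := radialArea)
      (ν := haarT) |>.ae ae_radialArea_mem
    filter_upwards [this] with z hz
    simp [abs_of_pos hz.1]
  rw [Measure.map_congr h]
  exact Measure.quasiMeasurePreserving_fst.absolutelyContinuous

/-- The Hölder inequality on circles. -/
lemma lintegral_ball_mul_le {ω : ℝ → ℝ} (hω : IsRadialWeight ω) {p q : ℝ}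
    (hpq : p.HolderConjugate q) {f : ℂ → ℂ}
    (hf : AEStronglyMeasurable f (volume.restrict (Metric.ball (0 : ℂ) 1)))
    {G : ℂ → ℝ≥0∞} (hG : Measurable G) {B : ℝ → ℝ≥0∞}
    (hB : AEMeasurable B (volume.restrict (Ioo 0 1)))
    (hGB : ∀ r ∈ Ioo (0 : ℝ) 1, (∫⁻ x, G (r * expT x) ^ q ∂haarT) ^ (1 / q) ≤ B r) :
    ∫⁻ ζ in Metric.ball (0 : ℂ) 1, ENNReal.ofReal (ω ‖ζ‖) * (‖f ζ‖ₑ * G ζ)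
      ≤ ENNReal.ofReal (2 * Real.pi) * ∫⁻ r, sliceNorm p f r * B r ∂radialMeasure ω := by
  have hm : AEMeasurable (fun ζ => ENNReal.ofReal (ω ‖ζ‖) * (‖f ζ‖ₑ * G ζ))
      (volume.restrict (Metric.ball (0 : ℂ) 1)) :=
    (aemeasurable_weight_comp_norm hω).ennreal_ofReal.mul (hf.enorm.mul hG.aemeasurable)
  have hmap := measurePreserving_polarT.map_eq
  have hm' : AEMeasurable (fun z : ℝ × Torus => ENNReal.ofReal (ω ‖(z.1 : ℂ) * expT z.2‖)
      * (‖f (z.1 * expT z.2)‖ₑ * G (z.1 * expT z.2))) (radialArea.prod haarT) :=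
    hm.comp_quasiMeasurePreserving measurePreserving_polarT.quasiMeasurePreserving
  have hsB : AEMeasurable (fun r => sliceNorm p f r * B r) (volume.restrict (Ioo 0 1)) :=
    (aemeasurable_sliceNorm hf).mul hB
  rw [← hmap, lintegral_map' (by rwa [hmap]) polarT_measurable.aemeasurable,
    lintegral_prod _ hm', ← lintegral_radialArea_mul_weight hω hsB]
  refine lintegral_mono_ae ?_
  filter_upwards [ae_radialArea_mem, (aestronglyMeasurable_comp_polarT hf).prodMk_left] with r hr hfr
  have h1 : ∀ x : Torus, ‖(r : ℂ) * expT x‖ = r := fun x => by simp [abs_of_pos hr.1]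
  simp only [h1]
  rw [lintegral_const_mul' _ _ ENNReal.ofReal_ne_top]
  have hGr : Measurable fun x : Torus => G (r * expT x) :=
    hG.comp (measurable_const.mul measurable_expT)
  have h2 := ENNReal.lintegral_mul_le_Lp_mul_Lq haarT hpq hfr.enorm hGr.aemeasurable
  gcongr
  refine h2.trans ?_
  gcongr
  · exact le_rfl
  · exact hGB r hr

lemma conj_bergmanKernel (ω : ℝ → ℝ) (z ζ : ℂ) :
    (starRingEnd ℂ) (bergmanKernel ω z ζ) = powerSum (kernelCoeff ω) (z * (starRingEnd ℂ) ζ) := by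
  rw [bergmanKernel, powerSum, Complex.conj_tsum]
  refine tsum_congr fun n => ?_
  simp only [kernelCoeff, map_div₀, map_pow, map_mul, Complex.conj_conj, Complex.conj_ofReal,
    map_ofNat, Complex.ofReal_inv, Complex.ofReal_mul, Complex.ofReal_ofNat]
  rw [div_eq_inv_mul, mul_comm z]

lemma continuousOn_omegaHat {ω : ℝ → ℝ} (hω : IsRadialWeight ω) :
    ContinuousOn (omegaHat ω) (Icc 0 1) := by
  have h : IntegrableOn ω (Icc 0 1) := (integrableOn_Icc_iff_integrableOn_Ico).2 hω.2
  have h2 := intervalIntegral.continuousOn_primitive_interval_left (a := 0) (b := 1) (f := ω)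
    (μ := volume)
    (by rwa [uIcc_of_le zero_le_one])
  rwa [uIcc_of_le zero_le_one] at h2

lemma lintegral_Ico_weight_eq {ω : ℝ → ℝ} (hω : IsRadialWeight ω) {a : ℝ} (ha : 0 ≤ a)
    (ha1 : a ≤ 1) :
    ∫⁻ s in Ico a 1, ENNReal.ofReal (ω s) = ENNReal.ofReal (omegaHat ω a) := by
  rw [omegaHat, intervalIntegral.integral_of_le ha1, ← integral_Ico_eq_integral_Ioc,
    ofReal_integral_eq_lintegral_ofReal (hω.2.mono_set (Ico_subset_Ico_left ha))]
  rw [EventuallyLE, ae_restrict_iff' measurableSet_Ico]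
  exact .of_forall fun s hs => hω.1 s ⟨ha.trans hs.1, hs.2⟩

lemma antitoneOn_omegaHat {ω : ℝ → ℝ} (hω : IsRadialWeight ω) :
    AntitoneOn (omegaHat ω) (Icc 0 1) := by
  intro a ha b hb hab
  have h : omegaHat ω a = (∫ s in a..b, ω s) + omegaHat ω b :=
    (intervalIntegral.integral_add_adjacent_intervals (hω.intervalIntegrable ha.1 hab hb.2)
      (hω.intervalIntegrable hb.1 hb.2 le_rfl)).symm
  have h2 : 0 ≤ ∫ s in a..b, ω s := by
    rw [intervalIntegral.integral_of_le hab, ← integral_Ico_eq_integral_Ioc]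
    exact setIntegral_nonneg measurableSet_Ico fun s hs => hω.1 s ⟨ha.1.trans hs.1, hs.2.trans_le hb.2⟩
  linarith

lemma radialMeasure_le_of_subset {ω : ℝ → ℝ} (hω : IsRadialWeight ω) {a : ℝ} (ha : 0 ≤ a)
    (ha1 : a ≤ 1)
    {S : Set ℝ} (hS : MeasurableSet S) (hSa : S ∩ Ioo 0 1 ⊆ Ico a 1) :
    radialMeasure ω S ≤ ENNReal.ofReal (omegaHat ω a) := by
  rw [radialMeasure, withDensity_apply _ hS, Measure.restrict_restrict hS,
    ← lintegral_Ico_weight_eq hω ha ha1]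
  calc ∫⁻ r in S ∩ Ioo 0 1, ENNReal.ofReal (r * ω r)
      ≤ ∫⁻ r in S ∩ Ioo 0 1, ENNReal.ofReal (ω r) := by
        refine setLIntegral_mono' (hS.inter measurableSet_Ioo) fun r hr => ?_
        refine ENNReal.ofReal_le_ofReal (mul_le_of_le_one_left
          (hω.1 r ⟨hr.2.1.le, hr.2.2⟩) hr.2.2.le)
    _ ≤ _ := lintegral_mono_set hSa

lemma isFiniteMeasure_radialMeasure {ω : ℝ → ℝ} (hω : IsRadialWeight ω) :
    IsFiniteMeasure (radialMeasure ω) :=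
  ⟨(radialMeasure_le_of_subset hω le_rfl zero_le_one MeasurableSet.univ
    fun _ hr => ⟨hr.2.1.le, hr.2.2⟩).trans_lt ENNReal.ofReal_lt_top⟩

open Classical in
/-- A measurable positive function that agrees with `omegaHat ω` on `(0,1)`. -/
def omegaHatExt (ω : ℝ → ℝ) : ℝ → ℝ := (Ioo (0 : ℝ) 1).piecewise (omegaHat ω) fun _ => 1

lemma omegaHatExt_of_mem {ω : ℝ → ℝ} {r : ℝ} (hr : r ∈ Ioo (0 : ℝ) 1) :
    omegaHatExt ω r = omegaHat ω r := piecewise_eq_of_mem _ _ _ hr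

lemma measurable_omegaHatExt {ω : ℝ → ℝ} (hω : IsRadialWeight ω) : Measurable (omegaHatExt ω) :=
  ContinuousOn.measurable_piecewise ((continuousOn_omegaHat hω).mono Ioo_subset_Icc_self)
    continuousOn_const measurableSet_Ioo

lemma omegaHatExt_pos {ω : ℝ → ℝ} (hpos : ∀ r ∈ Ico (0 : ℝ) 1, 0 < omegaHat ω r) (r : ℝ) :
    0 < omegaHatExt ω r := by
  by_cases hr : r ∈ Ioo (0 : ℝ) 1
  · rw [omegaHatExt_of_mem hr]
    exact hpos r ⟨hr.1.le, hr.2⟩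
  · rw [omegaHatExt, piecewise_eq_of_notMem _ _ _ hr]
    exact one_pos

lemma radialMeasure_omegaHatExt_le {ω : ℝ → ℝ} (hω : IsRadialWeight ω) {x : ℝ} (hx : 0 < x) :
    radialMeasure ω {s | omegaHatExt ω s ≤ x} ≤ ENNReal.ofReal x := by
  set K : Set ℝ := Icc 0 1 ∩ omegaHat ω ⁻¹' Iic x with hK
  have hKc : IsCompact K := isCompact_Icc.of_isClosed_subset
    ((continuousOn_omegaHat hω).preimage_isClosed_of_isClosed isClosed_Icc isClosed_Iic) inter_subset_left
  have h1 : (1 : ℝ) ∈ K := by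
    refine ⟨by simp, ?_⟩
    simp [omegaHat, hx.le]
  obtain ⟨a, ha, hmin⟩ := hKc.exists_isLeast ⟨1, h1⟩
  refine (radialMeasure_le_of_subset hω ha.1.1 ha.1.2
    (measurableSet_le (measurable_omegaHatExt hω) measurable_const) ?_).trans
    (ENNReal.ofReal_le_ofReal ha.2)
  intro s hs
  refine ⟨hmin ⟨Ioo_subset_Icc_self hs.2, ?_⟩, hs.2.2⟩
  have h : omegaHatExt ω s ≤ x := hs.1
  rwa [omegaHatExt_of_mem hs.2] at h

lemma sliceNorm_const_mul {p : ℝ} (hp : 0 < p) (c : ℂ) (f : ℂ → ℂ) (r : ℝ) :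
    sliceNorm p (fun z => c * f z) r = ‖c‖ₑ * sliceNorm p f r := by
  unfold sliceNorm
  simp_rw [enorm_mul, ENNReal.mul_rpow_of_nonneg _ _ hp.le]
  rw [lintegral_const_mul' _ _ (by finiteness), ENNReal.mul_rpow_of_nonneg _ _ (by positivity),
    ← ENNReal.rpow_mul, mul_one_div_cancel hp.ne', ENNReal.rpow_one]

lemma integral_haarT_integral_swap {Y : Type*} [MeasurableSpace Y] {ν : Measure Y} [SFinite ν]
    {M : ℂ → ℂ} (hM : ContinuousOn M (Metric.ball 0 1)) {φ ψ : Y → ℂ} (hφ : Integrable φ ν)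
    (hψ : AEStronglyMeasurable ψ ν) (hψ1 : ∀ᵐ y ∂ν, ‖ψ y‖ ≤ 1) {ρ : ℝ} (hρ : ρ ∈ Ico (0 : ℝ) 1)
    {h : Torus → ℂ} (hh : Continuous h) :
    ∫ x, (∫ y, φ y * M (ρ * expT x * ψ y) ∂ν) * h x ∂haarT
      = ∫ y, φ y * ∫ x, h x * M (ρ * expT x * ψ y) ∂haarT ∂ν := by
  have hnorm : ∀ x : Torus, ‖(ρ : ℂ) * expT x‖ = ρ := fun x => by simp [abs_of_nonneg hρ.1]
  have hmem : ∀ᵐ z ∂haarT.prod ν, ‖(ρ : ℂ) * expT z.1 * ψ z.2‖ ≤ ρ := by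
    filter_upwards [Measure.quasiMeasurePreserving_snd.ae hψ1] with z hz
    rw [norm_mul, hnorm]
    exact mul_le_of_le_one_right hρ.1 hz
  obtain ⟨K, hK⟩ := (isCompact_closedBall (0 : ℂ) ρ).exists_bound_of_continuousOn
    (hM.mono (Metric.closedBall_subset_ball hρ.2))
  obtain ⟨L, hL⟩ := isCompact_univ.exists_bound_of_continuousOn hh.continuousOn
  have hmeas : AEStronglyMeasurable (fun z : Torus × Y => M (ρ * expT z.1 * ψ z.2))
    (haarT.prod ν) := by
    refine ContinuousOn.aestronglyMeasurable_comp_of_ae_mem measurableSet_ball hM ?_ ?_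
    · exact ((measurable_const.mul (measurable_expT.comp measurable_fst)).aestronglyMeasurable).mul
        hψ.comp_snd
    · filter_upwards [hmem] with z hz
      exact mem_ball_zero_iff.2 (hz.trans_lt hρ.2)
  have hint : Integrable (fun z : Torus × Y => M (ρ * expT z.1 * ψ z.2) * (h z.1 * φ z.2))
      (haarT.prod ν) := by
    refine Integrable.bdd_mul (c := K) ?_ hmeas ?_
    · refine Integrable.bdd_mul (c := L) (hφ.comp_snd haarT)
        (hh.measurable.comp measurable_fst).aestronglyMeasurable
          (.of_forall fun z => hL z.1 trivial)
    · filter_upwards [hmem] with z hz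
      exact hK _ (mem_closedBall_zero_iff.2 hz)
  have hs := integral_integral_swap (f := fun (x : Torus) (y : Y) =>
    M (ρ * expT x * ψ y) * (h x * φ y)) hint
  calc _ = ∫ x, ∫ y, M (ρ * expT x * ψ y) * (h x * φ y) ∂ν ∂haarT := by
        refine integral_congr_ae (.of_forall fun x => ?_)
        dsimp only
        rw [← integral_mul_const]
        congr 1; ext y; ring
    _ = _ := hs
    _ = _ := by
        refine integral_congr_ae (.of_forall fun y => ?_)
        dsimp only
        rw [← integral_const_mul]
        congr 1; ext x; ring

lemma torusNorm_integral_mul_comp_le {M : ℂ → ℂ} (hM : ContinuousOn M (Metric.ball 0 1)) {p q : ℝ}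
    (hpq : p.HolderConjugate q) {r : ℝ} (hr : r ∈ Ico (0 : ℝ) 1) {B : ℝ} (hB : 0 ≤ B)
    (hMB : ∀ g h : Torus → ℂ, Continuous g → Continuous h →
      ‖convForm M r g h‖ ≤ B * (torusNorm p g * torusNorm q h))
    {h : Torus → ℂ} (hh : Continuous h) :
    torusNorm q (fun y => ∫ x, h x * M (r * expT (x - y)) ∂haarT) ≤ B * torusNorm q h := by
  have hc : Continuous (Function.uncurry fun y x : Torus => h x * M (r * expT (x - y))) :=
    (hh.comp continuous_snd).mul
      (continuous_comp_mul_expT hM hr (continuous_snd.sub continuous_fst))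
  refine torusNorm_le_of_dual hpq.symm (continuous_integral_haarT hc)
    (mul_nonneg hB (torusNorm_nonneg _ _)) fun g hg => ?_
  have h1 : ∫ y, (∫ x, h x * M (r * expT (x - y)) ∂haarT) * g y ∂haarT = convForm M r g h := by
    unfold convForm
    simp_rw [← integral_mul_const]
    rw [integral_haarT_swap (F := fun y x => h x * M (r * expT (x - y)) * g y)
      (hc.mul (hg.comp continuous_fst))]
    congr 1; ext x; congr 1; ext y; ring
  rw [h1]
  refine (hMB g h hg hh).trans_eq ?_
  ring

/-- The `L^p` mean of an integral operator with convolution type kernel on the circles. -/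
lemma sliceNorm_integral_le {ω : ℝ → ℝ} (hω : IsRadialWeight ω) {M : ℂ → ℂ}
    (hM : DifferentiableOn ℂ M (Metric.ball 0 1)) {p q : ℝ} (hpq : p.HolderConjugate q) {f : ℂ → ℂ}
    (hf : AEStronglyMeasurable f (volume.restrict (Metric.ball (0 : ℂ) 1)))
    (hfω : IntegrableOn (fun ζ => f ζ * (ω ‖ζ‖ : ℂ)) (Metric.ball 0 1))
    {ρ : ℝ} (hρ : ρ ∈ Ico (0 : ℝ) 1) {B : ℝ → ℝ} (hBm : Measurable B)
    (hB : ∀ s ∈ Ioo (0 : ℝ) 1, 0 ≤ B s)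
    (hMB : ∀ s ∈ Ioo (0 : ℝ) 1, ∀ g h : Torus → ℂ, Continuous g → Continuous h →
      ‖convForm M (ρ * s) g h‖ ≤ B s * (torusNorm p g * torusNorm q h)) :
    sliceNorm p (fun z => ∫ ζ in Metric.ball 0 1, f ζ * (ω ‖ζ‖ : ℂ) * M (z * (starRingEnd ℂ) ζ)) ρ
      ≤ ENNReal.ofReal (2 * Real.pi)
        * ∫⁻ s, sliceNorm p f s * ENNReal.ofReal (B s) ∂radialMeasure ω := by
  set R : ℝ≥0∞ := ENNReal.ofReal (2 * Real.pi)
    * ∫⁻ s, sliceNorm p f s * ENNReal.ofReal (B s) ∂radialMeasure ω with hR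
  rcases eq_or_ne R ⊤ with hRt | hRt
  · rw [hRt]
    exact le_top
  have hψm : AEStronglyMeasurable (fun ζ : ℂ => (starRingEnd ℂ) ζ)
      (volume.restrict (Metric.ball (0 : ℂ) 1)) := Complex.continuous_conj.aestronglyMeasurable
  have hψ1 : ∀ᵐ ζ ∂volume.restrict (Metric.ball (0 : ℂ) 1), ‖(starRingEnd ℂ) ζ‖ ≤ 1 := by
    filter_upwards [ae_restrict_mem measurableSet_ball] with ζ hζ
    rw [RCLike.norm_conj]
    exact (mem_ball_zero_iff.1 hζ).le
  have hF := (differentiableOn_integral_mul_comp hM hfω hψm hψ1).2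
  have hFc := continuous_comp_mul_expT hF.continuousOn hρ continuous_id
  simp only [id_eq] at hFc
  have hp0 : 0 < p := hpq.pos
  have hq0 : 0 < q := hpq.symm.pos
  rw [sliceNorm_eq_torusNorm hp0 hFc]
  refine ENNReal.ofReal_le_of_le_toReal (torusNorm_le_of_dual hpq hFc ENNReal.toReal_nonneg ?_)
  intro h hh
  rw [integral_haarT_integral_swap hM.continuousOn hfω hψm hψ1 hρ hh]
  set H : ℂ → ℂ := fun ζ => ∫ x, h x * M (ρ * expT x * (starRingEnd ℂ) ζ) ∂haarT with hH
  have hHc : ContinuousOn H (Metric.ball 0 1) := by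
    have h1 := (differentiableOn_integral_mul_comp hM (integrable_haarT hh)
      (ψ := fun x => ρ * expT x) (continuous_const.mul continuous_expT).aestronglyMeasurable
      (.of_forall fun x => by simpa [abs_of_nonneg hρ.1] using hρ.2.le)).2.continuousOn
    have h2 := h1.comp Complex.continuous_conj.continuousOn (s := Metric.ball 0 1)
      fun ζ hζ => by simpa using hζ
    refine h2.congr fun ζ _ => ?_
    simp only [hH, Function.comp, mul_comm ((starRingEnd ℂ) ζ)]
  have hslice : ∀ s ∈ Ioo (0 : ℝ) 1, ∀ y : Torus,
      H (s * expT y) = ∫ x, h x * M ((ρ * s : ℝ) * expT (x - y)) ∂haarT := by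
    intro s _ y
    simp only [hH]
    congr 1; ext x
    rw [map_mul, Complex.conj_ofReal, ← expT_neg, sub_eq_add_neg, expT_add, Complex.ofReal_mul]
    congr 2; ring
  classical
  set G : ℂ → ℝ≥0∞ := fun ζ => ‖(Metric.ball (0 : ℂ) 1).piecewise H (fun _ => 0) ζ‖ₑ with hG
  have hGm : Measurable G :=
    (ContinuousOn.measurable_piecewise hHc continuousOn_const measurableSet_ball).enorm
  have hGB : ∀ s ∈ Ioo (0 : ℝ) 1, (∫⁻ y, G (s * expT y) ^ q ∂haarT) ^ (1 / q)
      ≤ ENNReal.ofReal (B s) * ENNReal.ofReal (torusNorm q h) := by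
    intro s hs
    have hs' : s ∈ Ico (0 : ℝ) 1 := ⟨hs.1.le, hs.2⟩
    have hρs : ρ * s ∈ Ico (0 : ℝ) 1 :=
      ⟨mul_nonneg hρ.1 hs.1.le, mul_lt_one_of_nonneg_of_lt_one_left hρ.1 hρ.2 hs.2.le⟩
    have h1 : ∀ y : Torus, G (s * expT y) = ‖H (s * expT y)‖ₑ := fun y => by
      simp only [hG, piecewise_eq_of_mem _ _ _ (ofReal_mul_expT_mem_ball hs' y)]
    simp_rw [h1]
    change sliceNorm q H s ≤ _
    rw [sliceNorm_eq_torusNorm hq0 (continuous_comp_mul_expT hHc hs' continuous_id),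
      ← ENNReal.ofReal_mul (hB s hs)]
    refine ENNReal.ofReal_le_ofReal ?_
    simp_rw [hslice s hs]
    exact torusNorm_integral_mul_comp_le hM.continuousOn hpq hρs (hB s hs) (hMB s hs) hh
  have hmain := lintegral_ball_mul_le hω hpq hf hGm
    (hBm.ennreal_ofReal.mul_const _).aemeasurable hGB
  simp_rw [← mul_assoc] at hmain
  rw [lintegral_mul_const' _ _ ENNReal.ofReal_ne_top, ← mul_assoc, ← hR] at hmain
  have hle : ‖∫ ζ in Metric.ball 0 1, f ζ * (ω ‖ζ‖ : ℂ) * H ζ‖ₑ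
      ≤ R * ENNReal.ofReal (torusNorm q h) := by
    refine (enorm_integral_le_lintegral_enorm _).trans (le_trans (le_of_eq ?_) hmain)
    refine setLIntegral_congr_fun measurableSet_ball fun ζ hζ => ?_
    have hζ1 : ‖ζ‖ ∈ Ico (0 : ℝ) 1 := ⟨norm_nonneg _, mem_ball_zero_iff.1 hζ⟩
    simp only [hG, piecewise_eq_of_mem _ _ _ hζ, enorm_mul]
    rw [mul_comm ‖f ζ‖ₑ, ← ofReal_norm (ω ‖ζ‖ : ℂ), Complex.norm_real, Real.norm_of_nonneg
      (hω.1 _ hζ1)]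
  have := ENNReal.toReal_mono (by finiteness) hle
  rwa [toReal_enorm, ENNReal.toReal_mul, ENNReal.toReal_ofReal (torusNorm_nonneg _ _)] at this

lemma lintegral_sliceNorm_rpow_lt_top {ω : ℝ → ℝ} (hω : IsRadialWeight ω) {p q : ℝ} (hp : 0 < p)
    (hq : 0 < q) {f : ℂ → ℂ} (hf : AEStronglyMeasurable f (volume.restrict (Metric.ball (0 : ℂ) 1)))
    (hfin : LpqNormE ω p q f < ⊤) : ∫⁻ r, sliceNorm p f r ^ q ∂radialMeasure ω < ⊤ := by
  rw [LpqNormE_eq hω hp hf] at hfin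
  exact (ENNReal.rpow_lt_top_iff_of_pos (by positivity)).1 hfin

lemma aemeasurable_sliceNorm_radialMeasure {ω : ℝ → ℝ} {p : ℝ} {f : ℂ → ℂ}
    (hf : AEStronglyMeasurable f (volume.restrict (Metric.ball (0 : ℂ) 1))) :
    AEMeasurable (sliceNorm p f) (radialMeasure ω) :=
  (aemeasurable_sliceNorm hf).mono_ac (withDensity_absolutelyContinuous _ _)

lemma integrableOn_mul_weight {ω : ℝ → ℝ} (hω : IsRadialWeight ω) {p q : ℝ} (hp : 1 < p)
    (hq : 1 < q) {f : ℂ → ℂ} (hf : AEStronglyMeasurable f (volume.restrict (Metric.ball (0 : ℂ) 1)))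
    (hfin : LpqNormE ω p q f < ⊤) :
    IntegrableOn (fun ζ => f ζ * (ω ‖ζ‖ : ℂ)) (Metric.ball 0 1) := by
  have := isFiniteMeasure_radialMeasure hω
  refine ⟨hf.mul (Complex.measurable_ofReal.comp_aemeasurable
    (aemeasurable_weight_comp_norm hω)).aestronglyMeasurable, ?_⟩
  have h1 : ∫⁻ r, sliceNorm p f r * 1 ∂radialMeasure ω < ⊤ := by
    refine (ENNReal.lintegral_mul_le_Lp_mul_Lq (radialMeasure ω)
      (Real.HolderConjugate.conjExponent hq)
      (aemeasurable_sliceNorm_radialMeasure hf) aemeasurable_const).trans_lt ?_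
    have h := lintegral_sliceNorm_rpow_lt_top hω (zero_lt_one.trans hp)
      (zero_lt_one.trans hq) hf hfin
    have hq' := (Real.HolderConjugate.conjExponent hq).symm.pos
    refine ENNReal.mul_lt_top (ENNReal.rpow_lt_top_of_nonneg (by positivity) h.ne)
      (ENNReal.rpow_lt_top_of_nonneg (by positivity) ?_)
    simp
  have h2 := lintegral_ball_mul_le hω (Real.HolderConjugate.conjExponent hp) hf (G := fun _ => 1)
    (B := fun _ => 1) measurable_const aemeasurable_const (by simp)
  refine lt_of_le_of_lt (le_trans (le_of_eq ?_) h2) (ENNReal.mul_lt_top ENNReal.ofReal_lt_top h1)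
  refine setLIntegral_congr_fun measurableSet_ball fun ζ hζ => ?_
  have hζ1 : ‖ζ‖ ∈ Ico (0 : ℝ) 1 := ⟨norm_nonneg _, mem_ball_zero_iff.1 hζ⟩
  simp only [enorm_mul, mul_one]
  rw [mul_comm, ← ofReal_norm (ω ‖ζ‖ : ℂ), Complex.norm_real, Real.norm_of_nonneg (hω.1 _ hζ1)]

lemma exists_norm_convForm_kernel_le {ω : ℝ → ℝ} (hω : IsRadialWeight ω)
    (hpos : ∀ r ∈ Ico (0 : ℝ) 1, 0 < omegaHat ω r) (hD : InDhat ω) {p q : ℝ}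
    (hpq : p.HolderConjugate q) :
    DifferentiableOn ℂ (powerSum (kernelCoeff ω)) (Metric.ball 0 1) ∧
    ∃ C > 0, ∀ t ∈ Ico (0 : ℝ) 1, ∀ g h : Torus → ℂ, Continuous g → Continuous h →
      ‖convForm (powerSum (kernelCoeff ω)) t g h‖
        ≤ C / omegaHat ω t * (torusNorm p g * torusNorm q h) := by
  obtain ⟨C, hC, hCω⟩ := exists_tsum_kernelCoeff_le hω hpos hD
  obtain ⟨A, hA, hAM⟩ := exists_norm_convForm_powerSum_le hpq
  have hs : ∀ t ∈ Ico (0 : ℝ) 1, Summable fun j => kernelCoeff ω j * t ^ j := fun t ht =>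
    (hCω t ht).1
  refine ⟨differentiableOn_powerSum (kernelCoeff_nonneg hω hpos) hs, A * C, mul_pos hA hC,
    fun t ht g h hg hh => ?_⟩
  refine (hAM _ (kernelCoeff_nonneg hω hpos)
    (monotone_kernelCoeff hω hpos) hs t ht g h hg hh).trans ?_
  have h0 := mul_nonneg (torusNorm_nonneg p g) (torusNorm_nonneg q h)
  rw [mul_div_assoc]
  gcongr
  exact (hCω t ht).2

/-- For `ω ∈ D̂` and `1<p,q<∞`, the Bergman projection `P_ω` is bounded
on `L^{p,q}_ω`. -/
theorem bergman_projection_bounded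
    (ω : ℝ → ℝ) (hω : IsRadialWeight ω)
    (hpos : ∀ r ∈ Set.Ico (0:ℝ) 1, 0 < omegaHat ω r)
    (hD : InDhat ω)
    (p q : ℝ) (hp : 1 < p) (hq : 1 < q) :
    ∃ C > (0:ℝ), ∀ f : ℂ → ℂ,
      MeasureTheory.AEStronglyMeasurable f
        (MeasureTheory.volume.restrict (Metric.ball (0:ℂ) 1)) →
      LpqNormE ω p q f < ⊤ →
      (∀ z ∈ Metric.ball (0:ℂ) 1,
        MeasureTheory.IntegrableOn
          (fun ζ => f ζ * (starRingEnd ℂ) (bergmanKernel ω z ζ) * ((ω ‖ζ‖ : ℝ) : ℂ))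
          (Metric.ball (0:ℂ) 1)) ∧
      DifferentiableOn ℂ (PomegaProj ω f) (Metric.ball 0 1) ∧
      LpqNormE ω p q (PomegaProj ω f) ≤ ENNReal.ofReal C * LpqNormE ω p q f := by
  have hpq := Real.HolderConjugate.conjExponent hp
  have hp0 : 0 < p := zero_lt_one.trans hp
  have hq0 : 0 < q := zero_lt_one.trans hq
  obtain ⟨hM, A, hA, hAM⟩ := exists_norm_convForm_kernel_le hω hpos hD hpq
  obtain ⟨S, hS, hSN⟩ := exists_lintegral_inv_max_mul_rpow_le_mul hq
  set M := powerSum (kernelCoeff ω)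
  set v := omegaHatExt ω
  have hv : Measurable v := measurable_omegaHatExt hω
  have hv0 : ∀ s, 0 < v s := omegaHatExt_pos hpos
  have hMB : ∀ ρ ∈ Ioo (0 : ℝ) 1, ∀ s ∈ Ioo (0 : ℝ) 1, ∀ g h : Torus → ℂ, Continuous g →
      Continuous h → ‖convForm M (ρ * s) g h‖
        ≤ A * (max (v ρ) (v s))⁻¹ * (torusNorm p g * torusNorm p.conjExponent h) := by
    intro ρ hρ s hs g h hg hh
    have h1 : ρ * s ≤ ρ := mul_le_of_le_one_right hρ.1.le hs.2.le
    have h2 : ρ * s ≤ s := mul_le_of_le_one_left hs.1.le hρ.2.le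
    have h3 : ρ * s ∈ Ico (0 : ℝ) 1 := ⟨(mul_pos hρ.1 hs.1).le, h1.trans_lt hρ.2⟩
    refine (hAM _ h3 g h hg hh).trans ?_
    refine mul_le_mul_of_nonneg_right ?_ (mul_nonneg (torusNorm_nonneg _ _) (torusNorm_nonneg _ _))
    rw [div_eq_mul_inv]
    have h4 : max (v ρ) (v s) ≤ omegaHat ω (ρ * s) := by
      change max (omegaHatExt ω ρ) (omegaHatExt ω s) ≤ _
      rw [omegaHatExt_of_mem hρ, omegaHatExt_of_mem hs]
      exact max_le
        (antitoneOn_omegaHat hω (Ico_subset_Icc_self h3) (Ioo_subset_Icc_self hρ) h1)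
        (antitoneOn_omegaHat hω (Ico_subset_Icc_self h3) (Ioo_subset_Icc_self hs) h2)
    have h5 : 0 < max (v ρ) (v s) := lt_max_of_lt_left (hv0 ρ)
    gcongr
  refine ⟨2 * A * S ^ (1 / q), by positivity, fun f hf hfin => ?_⟩
  have hfω := integrableOn_mul_weight hω hp hq hf hfin
  have hconv := differentiableOn_integral_mul_comp hM hfω
    (ψ := fun ζ => (starRingEnd ℂ) ζ) Complex.continuous_conj.aestronglyMeasurable (by
      filter_upwards [ae_restrict_mem measurableSet_ball] with ζ hζ
      rw [RCLike.norm_conj]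
      exact (mem_ball_zero_iff.1 hζ).le)
  have hP : PomegaProj ω f = fun z => ((Real.pi⁻¹ : ℝ) : ℂ) *
      ∫ ζ in Metric.ball 0 1, f ζ * (ω ‖ζ‖ : ℂ) * M (z * (starRingEnd ℂ) ζ) := by
    ext z
    rw [PomegaProj, ← Complex.real_smul]
    simp only [conj_bergmanKernel, mul_right_comm]
    rfl
  have hPd : DifferentiableOn ℂ (PomegaProj ω f) (Metric.ball 0 1) := by
    rw [hP]
    exact hconv.2.const_mul _
  refine ⟨fun z hz => ?_, hPd, ?_⟩
  · simp only [conj_bergmanKernel, mul_right_comm]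
    exact hconv.1 z hz
  have hslice : ∀ ρ ∈ Ioo (0 : ℝ) 1, sliceNorm p (PomegaProj ω f) ρ ≤ ENNReal.ofReal (2 * A)
      * ∫⁻ s, sliceNorm p f s * ENNReal.ofReal (max (v ρ) (v s))⁻¹ ∂radialMeasure ω := by
    intro ρ hρ
    have h := sliceNorm_integral_le hω hM hpq hf hfω ⟨hρ.1.le, hρ.2⟩
      (B := fun s => A * (max (v ρ) (v s))⁻¹) ((measurable_const.max hv).inv.const_mul A)
      (fun s _ => mul_nonneg hA.le (inv_nonneg.2 (lt_max_of_lt_left (hv0 ρ)).le)) (hMB ρ hρ)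
    rw [hP, sliceNorm_const_mul hp0]
    simp_rw [ENNReal.ofReal_mul hA.le, mul_left_comm _ (ENNReal.ofReal A)] at h
    rw [lintegral_const_mul' _ _ ENNReal.ofReal_ne_top] at h
    refine (mul_le_mul_right h _).trans_eq ?_
    rw [← ofReal_norm, Complex.norm_real, Real.norm_of_nonneg (by positivity), ← mul_assoc,
      ← mul_assoc, ← ENNReal.ofReal_mul (by positivity), ← ENNReal.ofReal_mul (by positivity)]
    congr 2
    field_simp
  have hPm : AEStronglyMeasurable (PomegaProj ω f) (volume.restrict (Metric.ball (0 : ℂ) 1)) :=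
    hPd.continuousOn.aestronglyMeasurable measurableSet_ball
  have hae : ∀ᵐ ρ ∂radialMeasure ω, ρ ∈ Ioo (0 : ℝ) 1 :=
    (withDensity_absolutelyContinuous _ _).ae_le (ae_restrict_mem measurableSet_Ioo)
  have hint : ∫⁻ ρ, sliceNorm p (PomegaProj ω f) ρ ^ q ∂radialMeasure ω
      ≤ ENNReal.ofReal (2 * A) ^ q *
        (ENNReal.ofReal S * ∫⁻ s, sliceNorm p f s ^ q ∂radialMeasure ω) := by
    refine le_trans ?_ (mul_le_mul_right (hSN hv hv0
      (fun x hx => radialMeasure_omegaHatExt_le hω hx) _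
      (aemeasurable_sliceNorm_radialMeasure hf)) _)
    rw [← lintegral_const_mul' _ _ (by finiteness)]
    refine lintegral_mono_ae ?_
    filter_upwards [hae] with ρ hρ
    rw [← ENNReal.mul_rpow_of_nonneg _ _ hq0.le]
    exact ENNReal.rpow_le_rpow (hslice ρ hρ) hq0.le
  rw [LpqNormE_eq hω hp0 hPm, LpqNormE_eq hω hp0 hf]
  refine (ENNReal.rpow_le_rpow hint (by positivity)).trans_eq ?_
  rw [← mul_assoc, ENNReal.mul_rpow_of_nonneg _ _ (by positivity),
    ENNReal.mul_rpow_of_nonneg _ _ (by positivity), ← ENNReal.rpow_mul, mul_one_div_cancel hq0.ne',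
    ENNReal.rpow_one, ENNReal.ofReal_rpow_of_pos hS, ← ENNReal.ofReal_mul (by positivity)]
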